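/- arXiv:1907.08026 — 13 statements merged into one kernel-verified Lean document; each statement's English description precedes it below -/
import Mathlib

section
/- For every n ≥ 1, the polynomial S_n, regarded as a polynomial over ℂ, has exactly n distinct roots (so all roots are simple); every root is purely imaginary (has real part zero); and the set of roots is invariant under negation. Moreover, for n ≥ 2 the roots of S_{n−1} interlace those of S_n: writing the roots of S_n as iβ with β real, exactly one root of S_{n−1} lies in each open interval between consecutive values of β. -/
/-- `S_n(ζ) = Σ_{k=0}^{⌊n/2⌋} (n!/((n−2k)!·k!·k!))·ζ^{n−2k}` in `ℚ[ζ]`. -/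
noncomputable def S (n : ℕ) : Polynomial ℚ :=
  ∑ k ∈ Finset.range (n / 2 + 1),
    Polynomial.C ((n.factorial : ℚ) /
      ((Nat.factorial (n - 2 * k) * Nat.factorial k * Nat.factorial k : ℕ) : ℚ)) *
      Polynomial.X ^ (n - 2 * k)

/-- `S n` regarded as a polynomial over `ℂ`. -/
noncomputable def Sc (n : ℕ) : Polynomial ℂ := (S n).map (algebraMap ℚ ℂ)

open Polynomial in
lemma S_eq (n N : ℕ) (h : n / 2 + 1 ≤ N) :
    S n = ∑ k ∈ Finset.range N,
      C ((n.descFactorial (2 * k) : ℚ) / ((k.factorial : ℚ) * k.factorial)) * X ^ (n - 2 * k) := by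
  unfold S
  rw [← Finset.sum_subset (Finset.range_mono h)]
  · apply Finset.sum_congr rfl
    intro k hk
    have hk' : 2 * k ≤ n := by
      have := Finset.mem_range.1 hk
      omega
    congr 2
    have h1 := Nat.factorial_mul_descFactorial hk'
    rw [← h1]
    push_cast
    have := Nat.factorial_ne_zero (n - 2 * k)
    have := Nat.factorial_ne_zero k
    field_simp
  · intro k _ hk
    have : n < 2 * k := by
      have := fun h => hk (Finset.mem_range.2 h)
      by_contra hlt
      exact this (by omega)
    rw [Nat.descFactorial_of_lt this]
    simp

open Polynomial in
lemma S_deriv (n : ℕ) : derivative (S (n + 1)) = C ((n : ℚ) + 1) * S n := by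
  rw [S_eq (n + 1) (n + 2) (by omega), S_eq n (n + 2) (by omega), derivative_sum, Finset.mul_sum]
  apply Finset.sum_congr rfl
  intro k _
  rw [derivative_C_mul_X_pow, ← mul_assoc, ← C_mul, show n + 1 - 2 * k - 1 = n - 2 * k by omega]
  congr 2
  have h : ((n + 1).descFactorial (2 * k)) * (n + 1 - 2 * k) = (n + 1) * n.descFactorial (2 * k) := by
    rw [mul_comm, ← Nat.descFactorial_succ, Nat.succ_descFactorial_succ]
  have h' : (((n + 1).descFactorial (2 * k) : ℕ) : ℚ) * ((n + 1 - 2 * k : ℕ) : ℚ)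
      = ((n : ℚ) + 1) * (n.descFactorial (2 * k) : ℕ) := by exact_mod_cast h
  rw [div_mul_eq_mul_div, h', mul_div_assoc]

open Polynomial in
lemma S_zero : S 0 = 1 := by simp [S]

open Polynomial in
lemma S_eval_zero_even (m : ℕ) : (S (2 * m)).eval 0 = (Nat.centralBinom m : ℚ) := by
  unfold S
  rw [eval_finsetSum, Finset.sum_eq_single m]
  · have := Nat.factorial_ne_zero m
    rw [Nat.centralBinom, Nat.choose_eq_factorial_div_factorial (by omega),
      Nat.cast_div (Nat.factorial_mul_factorial_dvd_factorial (by omega))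
        (by simp [Nat.factorial_ne_zero])]
    simp [show 2 * m - m = m by omega]
  · intro k hk hkm
    have := Finset.mem_range.1 hk
    have : 2 * m - 2 * k ≠ 0 := by omega
    simp [this]
  · intro h
    exact absurd (Finset.mem_range.2 (by omega)) h

open Polynomial in
lemma S_eval_zero_odd (m : ℕ) : (S (2 * m + 1)).eval 0 = 0 := by
  unfold S
  rw [eval_finsetSum]
  apply Finset.sum_eq_zero
  intro k hk
  have := Finset.mem_range.1 hk
  have : 2 * m + 1 - 2 * k ≠ 0 := by omega
  simp [this]

lemma S_eval_zero_rec (n : ℕ) :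
    ((n : ℚ) + 2) * (S (n + 2)).eval 0 = 4 * (n + 1) * (S n).eval 0 := by
  rcases Nat.even_or_odd' n with ⟨m, rfl | rfl⟩
  · rw [show 2 * m + 2 = 2 * (m + 1) by ring, S_eval_zero_even, S_eval_zero_even]
    have h := Nat.succ_mul_centralBinom_succ m
    have h' : ((m : ℚ) + 1) * (Nat.centralBinom (m + 1) : ℚ)
      = 2 * (2 * m + 1) * (Nat.centralBinom m : ℚ) := by exact_mod_cast h
    push_cast
    linear_combination 2 * h'
  · rw [show 2 * m + 1 + 2 = 2 * (m + 1) + 1 by ring, S_eval_zero_odd, S_eval_zero_odd]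
    simp

open Polynomial in
lemma S_rec (n : ℕ) : C ((n : ℚ) + 1) * S (n + 1) =
    C (2 * (n : ℚ) + 1) * X * S n - (X ^ 2 - C 4) * derivative (S n) := by
  induction n with
  | zero =>
    simp [S]
  | succ n ih =>
    rw [← sub_eq_zero]
    set P := C (((n + 1 : ℕ) : ℚ) + 1) * S (n + 1 + 1) -
      (C (2 * ((n + 1 : ℕ) : ℚ) + 1) * X * S (n + 1) - (X ^ 2 - C 4) * derivative (S (n + 1))) with hP
    have hd : derivative P = 0 := by
      rw [hP, S_deriv n]
      simp only [derivative_sub, derivative_mul, derivative_C, derivative_X, derivative_X_pow,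
        S_deriv]
      have e : C ((n : ℚ) + 1) * (C ((n : ℚ) + 1) * S (n + 1)) = C ((n : ℚ) + 1) * (
        C (2 * (n : ℚ) + 1) * X * S n - (X ^ 2 - C 4) * derivative (S n)) := by rw [ih]
      simp only [map_add, map_mul, map_one, map_natCast, map_ofNat, Nat.cast_add, Nat.cast_one] at e ⊢
      simp only [Nat.reduceSub, pow_one, Nat.cast_ofNat]
      linear_combination e
    have h0 : P.eval 0 = 0 := by
      rw [hP, S_deriv n]
      have := S_eval_zero_rec n
      simp
      linear_combination this
    have hc := derivative_eq_zero.1 hd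
    rw [eq_C_of_natDegree_eq_zero hc] at h0 ⊢
    simpa using h0

lemma S_ne_zero (n : ℕ) : S n ≠ 0 := by
  induction n with
  | zero => simp [S_zero]
  | succ n ih =>
    intro h
    have := S_deriv n
    rw [h] at this
    rw [Polynomial.derivative_zero, eq_comm, mul_eq_zero, Polynomial.C_eq_zero] at this
    exact this.elim (by positivity) ih

open Polynomial in
/-- The real polynomials `R_n(x) = i^{-n} S_n(ix)`. -/
noncomputable def R : ℕ → Polynomial ℝ
  | 0 => 1
  | (n + 1) => C (((n : ℝ) + 1)⁻¹) *
      (C (2 * (n : ℝ) + 1) * X * R n - (X ^ 2 + C 4) * derivative (R n))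

open Polynomial in
lemma R_rec (n : ℕ) : C ((n : ℝ) + 1) * R (n + 1) =
    C (2 * (n : ℝ) + 1) * X * R n - (X ^ 2 + C 4) * derivative (R n) := by
  rw [R, ← mul_assoc, ← C_mul, mul_inv_cancel₀ (by positivity)]
  simp

open Polynomial in
lemma Sc_comp (n : ℕ) : (Sc n).comp (C Complex.I * X) =
    C (Complex.I ^ n) * (R n).map Complex.ofRealHom := by
  induction n with
  | zero => simp [Sc, S_zero, R]
  | succ n ih =>
    have hS := congrArg (fun p => (p.map (algebraMap ℚ ℂ)).comp (C Complex.I * X)) (S_rec n)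
    have hR := congrArg (fun p => p.map Complex.ofRealHom) (R_rec n)
    have hD := congrArg derivative ih
    rw [derivative_comp] at hD
    simp only [Polynomial.map_mul, Polynomial.map_sub, Polynomial.map_add, Polynomial.map_pow, map_X,
      map_C, mul_comp, sub_comp, pow_comp, X_comp, C_comp, ← derivative_map] at hS hR
    simp only [derivative_mul, derivative_C, derivative_X, derivative_map, zero_mul, zero_add,
      mul_one] at hD
    change _ * (Sc (n+1)).comp _ = _ * (Sc n).comp _ - _ * (derivative (Sc n)).comp _ at hS
    have hI : (C Complex.I : ℂ[X]) * C Complex.I = -1 := by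
      rw [← C_mul, Complex.I_mul_I]; simp
    have hn : (C ((n : ℂ) + 1) : ℂ[X]) ≠ 0 := by
      rw [C_ne_zero]; exact_mod_cast Nat.succ_ne_zero n
    apply mul_left_cancel₀ hn
    simp only [map_add, map_mul, map_one, map_natCast, map_ofNat, map_pow, pow_succ] at *
    rw [ih] at hS
    rw [derivative_map] at hR
    linear_combination hS - C Complex.I ^ n * C Complex.I * hR - (X ^ 2 + 4) * C Complex.I * hD
      + 4 * (derivative (Sc n)).comp (C Complex.I * X) * hI

open Polynomial in
lemma R_ne_zero (n : ℕ) : R n ≠ 0 := by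
  intro h
  have h1 := Sc_comp n
  rw [h, Polynomial.map_zero, mul_zero] at h1
  rw [comp_C_mul_X_eq_zero_iff (mem_nonZeroDivisors_of_ne_zero Complex.I_ne_zero)] at h1
  unfold Sc at h1
  rw [Polynomial.map_eq_zero_iff (algebraMap ℚ ℂ).injective] at h1
  exact S_ne_zero n h1

lemma root_iff (n : ℕ) (β : ℝ) : (Sc n).IsRoot (Complex.I * (β : ℂ)) ↔ (R n).eval β = 0 := by
  have h := congrArg (Polynomial.eval (β : ℂ)) (Sc_comp n)
  rw [Polynomial.eval_comp] at h
  simp only [Polynomial.eval_mul, Polynomial.eval_C, Polynomial.eval_X] at h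
  rw [Polynomial.IsRoot, h, mul_eq_zero, or_iff_right (pow_ne_zero _ Complex.I_ne_zero)]
  have : ((R n).map Complex.ofRealHom).eval (β : ℂ) = (((R n).eval β : ℝ) : ℂ) :=
    Polynomial.eval_map_apply (p := R n) (f := Complex.ofRealHom) β
  rw [this]
  simp

open Polynomial in
lemma R_deriv (n : ℕ) : derivative (R (n + 1)) = C ((n : ℝ) + 1) * R n := by
  induction n with
  | zero => simp [R]
  | succ n ih =>
    have hn : (C (((n + 1 : ℕ) : ℝ) + 1) : ℝ[X]) ≠ 0 := by
      rw [C_ne_zero]; positivity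
    apply mul_left_cancel₀ hn
    have h1 := congrArg derivative (R_rec (n + 1))
    have h2 := R_rec n
    rw [ih] at h1
    simp only [derivative_sub, derivative_add, derivative_mul, derivative_C, derivative_X,
      derivative_X_pow, ih] at h1
    simp only [map_add, map_mul, map_one, map_natCast, map_ofNat, Nat.cast_add, Nat.cast_one,
      Nat.reduceSub, pow_one, Nat.cast_ofNat] at *
    linear_combination h1 - ((n : ℝ[X]) + 1) * h2

lemma R_natDegree (n : ℕ) : (R n).natDegree ≤ n := by
  induction n with
  | zero => simp [R]
  | succ n ih =>
    rw [R]
    have := Polynomial.natDegree_derivative_le (R n)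
    rcases n with _ | n
    · simp [R]
    · refine (Polynomial.natDegree_C_mul_le _ _).trans ?_
      refine (Polynomial.natDegree_sub_le _ _).trans (max_le ?_ ?_)
      · refine Polynomial.natDegree_mul_le.trans ?_
        have : (Polynomial.C (2 * ((n + 1 : ℕ) : ℝ) + 1) * Polynomial.X).natDegree ≤ 1 :=
          (Polynomial.natDegree_C_mul_le _ _).trans Polynomial.natDegree_X_le
        omega
      · refine Polynomial.natDegree_mul_le.trans ?_
        have : (Polynomial.X ^ 2 + Polynomial.C (4 : ℝ)).natDegree = 2 := Polynomial.natDegree_X_pow_add_C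
        omega

/-- Rolle function. -/
noncomputable def G (n : ℕ) (φ : ℝ) : ℝ :=
  ∑ j ∈ Finset.range (n + 1), (R n).coeff j * ((2 * Real.sin φ) ^ j * Real.cos φ ^ (2 * n + 1 - j))

lemma G_eq (n : ℕ) (φ : ℝ) (h : Real.cos φ ≠ 0) :
    G n φ = Real.cos φ ^ (2 * n + 1) * (R n).eval (2 * Real.tan φ) := by
  rw [Polynomial.eval_eq_sum_range' (Nat.lt_succ_of_le (R_natDegree n)), Finset.mul_sum, G]
  apply Finset.sum_congr rfl
  intro j hj
  have hj' : j ≤ 2 * n + 1 := by have := Finset.mem_range.1 hj; omega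
  obtain ⟨l, hl⟩ := Nat.exists_eq_add_of_le hj'
  rw [hl, Nat.add_sub_cancel_left, Real.tan_eq_sin_div_cos, pow_add, mul_pow, mul_pow, div_pow]
  field_simp

lemma G_zero (n : ℕ) (φ : ℝ) (h : Real.cos φ = 0) : G n φ = 0 := by
  apply Finset.sum_eq_zero
  intro j hj
  have := Finset.mem_range.1 hj
  rw [h, zero_pow (by omega)]
  simp

lemma G_cont (n : ℕ) : Continuous (G n) := by
  unfold G
  fun_prop

lemma rolle (n : ℕ) (a b : ℝ) (ha : -(Real.pi / 2) ≤ a) (hb : b ≤ Real.pi / 2) (hab : a < b)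
    (h1 : G n a = 0) (h2 : G n b = 0) :
    ∃ c ∈ Set.Ioo a b, (R (n + 1)).eval (2 * Real.tan c) = 0 := by
  obtain ⟨c, hc, hd⟩ := exists_deriv_eq_zero hab (G_cont n).continuousOn (h1.trans h2.symm)
  refine ⟨c, hc, ?_⟩
  have hcos : ∀ x ∈ Set.Ioo a b, 0 < Real.cos x := fun x hx =>
    Real.cos_pos_of_mem_Ioo ⟨ha.trans_lt hx.1, hx.2.trans_le hb⟩
  have he : G n =ᶠ[nhds c] fun φ => Real.cos φ ^ (2 * n + 1) * (R n).eval (2 * Real.tan φ) := by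
    filter_upwards [Ioo_mem_nhds hc.1 hc.2] with x hx
    exact G_eq n x (hcos x hx).ne'
  rw [he.deriv_eq] at hd
  have h0 := (hcos c hc).ne'
  have hder : HasDerivAt (fun φ => Real.cos φ ^ (2 * n + 1) * (R n).eval (2 * Real.tan φ)) _ c :=
    ((Real.hasDerivAt_cos c).pow (2 * n + 1)).mul
      (HasDerivAt.comp (h₂ := fun x => (R n).eval x) c ((R n).hasDerivAt (2 * Real.tan c)) ((Real.hasDerivAt_tan h0).const_mul 2))
  rw [hder.deriv] at hd
  have hr := congrArg (Polynomial.eval (2 * Real.tan c)) (R_rec n)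
  simp at hr
  simp at hd
  set E := (R n).eval (2 * Real.tan c)
  set D := (R n).derivative.eval (2 * Real.tan c)
  have hE : (2 * (n : ℝ) + 1) * Real.sin c * E * Real.cos c = 2 * D := by
    have hp := pow_ne_zero (2 * n) h0
    rw [pow_succ] at hd
    field_simp at hd
    rw [mul_zero] at hd
    have hd' := (mul_eq_zero.1 hd).resolve_left hp
    linear_combination -hd'
  have hsc := Real.sin_sq_add_cos_sq c
  have hz : (2 * (n : ℝ) + 1) * (2 * Real.tan c) * E - ((2 * Real.tan c) ^ 2 + 4) * D = 0 := by
    rw [Real.tan_eq_sin_div_cos]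
    field_simp
    linear_combination 2 * hE - 4 * D * hsc
  rw [hz] at hr
  exact (mul_eq_zero.1 hr).resolve_left (by positivity)

lemma R_card (n : ℕ) : n ≤ (R n).roots.toFinset.card := by
  induction n with
  | zero => simp
  | succ n ih =>
    have hmono : StrictMono (fun x : ℝ => Real.arctan (x / 2)) := fun x y h =>
      Real.arctan_strictMono (by linarith)
    set f := fun x : ℝ => Real.arctan (x / 2) with hf
    have htan : ∀ x, 2 * Real.tan (f x) = x := fun x => by
      simp only [hf, Real.tan_arctan]; ring
    have hpi := Real.pi_pos
    set s0 := (R n).roots.toFinset.image f with hs0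
    set t := (R (n + 1)).roots.toFinset.image f with ht
    have hl : ∀ x ∈ s0, -(Real.pi / 2) < x ∧ x < Real.pi / 2 := by
      intro x hx
      obtain ⟨y, -, rfl⟩ := Finset.mem_image.1 hx
      exact ⟨Real.neg_pi_div_two_lt_arctan _, Real.arctan_lt_pi_div_two _⟩
    have c0 : s0.card = (R n).roots.toFinset.card := Finset.card_image_of_injective _ hmono.injective
    have c1 : t.card = (R (n + 1)).roots.toFinset.card :=
      Finset.card_image_of_injective _ hmono.injective
    have n1 : Real.pi / 2 ∉ s0 := fun h => (lt_irrefl _ (hl _ h).2)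
    have n2 : -(Real.pi / 2) ∉ insert (Real.pi / 2) s0 := fun h => by
      rcases Finset.mem_insert.1 h with h | h
      · linarith
      · exact lt_irrefl _ (hl _ h).1
    have key : (insert (-(Real.pi / 2)) (insert (Real.pi / 2) s0)).card ≤ t.card + 1 := by
      have hz : ∀ x ∈ insert (-(Real.pi / 2)) (insert (Real.pi / 2) s0),
          -(Real.pi / 2) ≤ x ∧ x ≤ Real.pi / 2 ∧ G n x = 0 := by
        intro x hx
        rcases Finset.mem_insert.1 hx with rfl | hx
        · exact ⟨le_rfl, by linarith, G_zero _ _ (by simp)⟩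
        rcases Finset.mem_insert.1 hx with rfl | hx
        · exact ⟨by linarith, le_rfl, G_zero _ _ (by simp)⟩
        refine ⟨(hl x hx).1.le, (hl x hx).2.le, ?_⟩
        rw [G_eq _ _ (Real.cos_pos_of_mem_Ioo (hl x hx)).ne']
        obtain ⟨y, hy, rfl⟩ := Finset.mem_image.1 hx
        rw [htan]
        have : (R n).eval y = 0 := by simpa [R_ne_zero] using hy
        rw [this, mul_zero]
      apply Finset.card_le_of_interleaved
      intro x hx y hy hxy _
      obtain ⟨c, hc, h0⟩ := rolle n x y (hz x hx).1 (hz y hy).2.1 hxy (hz x hx).2.2 (hz y hy).2.2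
      refine ⟨c, Finset.mem_image.2 ⟨2 * Real.tan c, ?_, ?_⟩, hc.1, hc.2⟩
      · simpa [R_ne_zero] using h0
      · simp only [hf]
        rw [mul_div_cancel_left₀ _ (by norm_num), Real.arctan_tan]
        · linarith [(hz x hx).1, hc.1]
        · linarith [(hz y hy).2.1, hc.2]
    rw [Finset.card_insert_of_notMem n2, Finset.card_insert_of_notMem n1] at key
    omega

lemma S_natDegree (n : ℕ) : (S n).natDegree ≤ n := by
  unfold S
  apply Polynomial.natDegree_sum_le_of_forall_le
  intro k _
  exact (Polynomial.natDegree_C_mul_X_pow_le _ _).trans (by omega)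

lemma S_neg (n : ℕ) (z : ℂ) : (Sc n).eval (-z) = (-1) ^ n * (Sc n).eval z := by
  unfold Sc S
  simp only [Polynomial.eval_map, Polynomial.eval₂_finsetSum, Finset.mul_sum]
  apply Finset.sum_congr rfl
  intro k hk
  have hk' : 2 * k ≤ n := by
    have := Finset.mem_range.1 hk
    omega
  obtain ⟨l, rfl⟩ := Nat.exists_eq_add_of_le hk'
  rw [Nat.add_sub_cancel_left]
  simp only [Polynomial.eval₂_mul, Polynomial.eval₂_C, Polynomial.eval₂_X_pow]
  rw [neg_pow, pow_add, pow_mul]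
  ring

/-- For `n ≥ 1`, `S_n` over `ℂ` has exactly `n` distinct roots (so all roots are simple);
every root is purely imaginary; the set of roots is invariant under negation; and for
`n ≥ 2` the roots of `S_{n−1}` interlace those of `S_n`: exactly one root of `S_{n−1}`
lies in each open interval between consecutive values of `β`, where the roots of `S_n`
are written as `iβ` with `β` real. -/
theorem stmt3 (n : ℕ) (hn : 1 ≤ n) :
    (Sc n).roots.toFinset.card = n ∧
    (∀ z ∈ (Sc n).roots, z.re = 0) ∧
    (∀ z : ℂ, (Sc n).IsRoot z → (Sc n).IsRoot (-z)) ∧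
    (2 ≤ n → ∀ β₁ β₂ : ℝ, β₁ < β₂ →
      (Sc n).IsRoot (Complex.I * (β₁ : ℂ)) → (Sc n).IsRoot (Complex.I * (β₂ : ℂ)) →
      (∀ β ∈ Set.Ioo β₁ β₂, ¬ (Sc n).IsRoot (Complex.I * (β : ℂ))) →
      ∃! γ : ℝ, γ ∈ Set.Ioo β₁ β₂ ∧ (Sc (n - 1)).IsRoot (Complex.I * (γ : ℂ))) := by
  have hSc : Sc n ≠ 0 := by
    unfold Sc
    rw [Polynomial.map_ne_zero_iff (algebraMap ℚ ℂ).injective]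
    exact S_ne_zero n
  have hsub : (R n).roots.toFinset.image (fun β : ℝ => Complex.I * (β : ℂ)) ⊆
      (Sc n).roots.toFinset := by
    intro z hz
    obtain ⟨β, hβ, rfl⟩ := Finset.mem_image.1 hz
    rw [Multiset.mem_toFinset, Polynomial.mem_roots hSc, root_iff]
    simpa [R_ne_zero] using hβ
  have hinj : Function.Injective (fun β : ℝ => Complex.I * (β : ℂ)) := by
    intro x y h
    simpa using h
  have hcard : n ≤ ((R n).roots.toFinset.image (fun β : ℝ => Complex.I * (β : ℂ))).card := by
    rw [Finset.card_image_of_injective _ hinj]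
    exact R_card n
  have hle : (Sc n).roots.toFinset.card ≤ n :=
    (Multiset.toFinset_card_le _).trans ((Polynomial.card_roots' _).trans
      (Polynomial.natDegree_map_le.trans (S_natDegree n)))
  have heq := Finset.eq_of_subset_of_card_le hsub (hle.trans hcard)
  refine ⟨le_antisymm hle (hcard.trans (Finset.card_le_card hsub)), ?_, ?_, ?_⟩
  · intro z hz
    rw [← Multiset.mem_toFinset, ← heq] at hz
    obtain ⟨β, -, rfl⟩ := Finset.mem_image.1 hz
    simp
  · intro z hz
    rw [Polynomial.IsRoot, S_neg, hz.eq_zero, mul_zero]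
  · intro h2 β₁ β₂ hlt r1 r2 hno
    obtain ⟨m, rfl⟩ : ∃ m, n = m + 1 := ⟨n - 1, by omega⟩
    simp only [root_iff, Nat.add_sub_cancel] at *
    have uniq : ∀ x ∈ Set.Ioo β₁ β₂, ∀ y ∈ Set.Ioo β₁ β₂, (R m).eval x = 0 → (R m).eval y = 0 →
        ¬ x < y := by
      intro x hx y hy ex ey hxy
      have htan : ∀ x : ℝ, 2 * Real.tan (Real.arctan (x / 2)) = x := fun x => by
        rw [Real.tan_arctan]; ring
      obtain ⟨c, hc, h0⟩ := rolle m (Real.arctan (x / 2)) (Real.arctan (y / 2))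
        (Real.neg_pi_div_two_lt_arctan _).le (Real.arctan_lt_pi_div_two _).le
        (Real.arctan_strictMono (by linarith))
        (by rw [G_eq _ _ (Real.cos_arctan_pos _).ne', htan, ex, mul_zero])
        (by rw [G_eq _ _ (Real.cos_arctan_pos _).ne', htan, ey, mul_zero])
      have hc1 : -(Real.pi / 2) < c := (Real.neg_pi_div_two_lt_arctan _).trans hc.1
      have hc2 : c < Real.pi / 2 := hc.2.trans (Real.arctan_lt_pi_div_two _)
      have e : c = Real.arctan (Real.tan c) := (Real.arctan_tan hc1 hc2).symm
      have l1 := hc.1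
      have l2 := hc.2
      rw [e, Real.arctan_strictMono.lt_iff_lt] at l1 l2
      exact hno _ ⟨by linarith [hx.1], by linarith [hy.2]⟩ h0
    obtain ⟨c, hc, hd⟩ := exists_deriv_eq_zero hlt (R (m + 1)).continuous.continuousOn
      (r1.trans r2.symm)
    rw [Polynomial.deriv, R_deriv, Polynomial.eval_mul, Polynomial.eval_C] at hd
    have hc0 : (R m).eval c = 0 :=
      (mul_eq_zero.1 hd).resolve_left (by positivity)
    refine ⟨c, ⟨hc, hc0⟩, ?_⟩
    rintro y ⟨hy, hy0⟩
    exact le_antisymm (not_lt.1 (uniq c hc y hy hc0 hy0)) (not_lt.1 (uniq y hy c hc hy0 hc0))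
end

section
/- For every integer ν ≥ 1, the polynomial B_ν(y) = Σ_{μ=0}^{ν} ((2ν)!/((2μ)!·((ν−μ)!)²))·y^μ has exactly ν roots, and all of its roots are real, negative, and simple. -/
/-- `B_ν(y) = Σ_{μ=0}^{ν} ((2ν)!/((2μ)!·((ν−μ)!)²))·y^μ` in `ℚ[y]`,
so that `B_ν(ζ²) = S_{2ν}(ζ)`. -/
noncomputable def Bnu (ν : ℕ) : Polynomial ℚ :=
  ∑ μ ∈ Finset.range (ν + 1),
    Polynomial.C (((2 * ν).factorial : ℚ) /
      ((Nat.factorial (2 * μ) * (Nat.factorial (ν - μ) * Nat.factorial (ν - μ)) : ℕ) : ℚ)) *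
      Polynomial.X ^ μ

open Polynomial in
theorem aux_rolle (p : ℝ[X]) (k : ℕ) : p.roots.card ≤ (derivative^[k] p).roots.card + k := by
  induction k with
  | zero => simp
  | succ k ih =>
    rw [Function.iterate_succ_apply']
    have := card_roots_le_derivative (derivative^[k] p)
    omega

open Polynomial in
theorem aux_roots (n : ℕ) : 2 * n ≤ (((X ^ 2 - 1 : ℝ[X])) ^ n).roots.card := by
  have : (X ^ 2 - 1 : ℝ[X]) = (X - C 1) * (X - C (-1)) := by
    simp only [map_neg, map_one]; ring
  rw [roots_pow, this, roots_mul (mul_ne_zero (X_sub_C_ne_zero _) (X_sub_C_ne_zero _)),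
    roots_X_sub_C, roots_X_sub_C]
  simp [mul_comm]

open Polynomial in
theorem aux_legendre (n : ℕ) (hn : 1 ≤ n) (x : ℂ)
    (hx : (derivative^[n] ((X ^ 2 - 1 : ℂ[X]) ^ n)).eval x = 0) : x.im = 0 := by
  set Q : ℝ[X] := derivative^[n] ((X ^ 2 - 1 : ℝ[X]) ^ n) with hQ
  have h1 : n ≤ Q.roots.card := by
    have := aux_rolle ((X ^ 2 - 1 : ℝ[X]) ^ n) n
    have := aux_roots n
    rw [← hQ] at *
    omega
  have hQ0 : Q ≠ 0 := by
    intro h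
    rw [h] at h1
    simp at h1
    omega
  have hdeg : Q.natDegree ≤ n := by
    have h2 := natDegree_iterate_derivative ((X ^ 2 - 1 : ℝ[X]) ^ n) n
    have h3 : ((X ^ 2 - 1 : ℝ[X]) ^ n).natDegree ≤ n * 2 := by
      refine natDegree_pow_le_of_le n ?_
      compute_degree
    rw [← hQ] at h2
    omega
  have hs : Q.Splits := by
    rw [splits_iff_card_roots]
    have := Q.card_roots'
    omega
  have hmap : derivative^[n] ((X ^ 2 - 1 : ℂ[X]) ^ n) = Q.map (algebraMap ℝ ℂ) := by
    rw [hQ, ← iterate_derivative_map]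
    simp
  rw [hmap] at hx
  have hmem : x ∈ (Q.map (algebraMap ℝ ℂ)).roots := by
    rw [mem_roots (map_ne_zero hQ0)]
    exact hx
  rw [hs.roots_map] at hmem
  obtain ⟨r, -, rfl⟩ := Multiset.mem_map.1 hmem
  simp

open Polynomial in
theorem aux_coeff_even (a : ℂ) (j : ℕ) :
    ((X ^ 2 + C a : ℂ[X]) ^ (2 * j)).coeff (2 * j) = ((2 * j).choose j : ℂ) * a ^ j := by
  have : (X ^ 2 + C a : ℂ[X]) ^ (2 * j) = expand ℂ 2 ((X + C a) ^ (2 * j)) := by simp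
  rw [this, mul_comm 2 j, coeff_expand_mul (by norm_num), coeff_X_add_C_pow]
  rw [mul_comm]; congr 2; omega

open Polynomial in
theorem aux_coeff_odd (a : ℂ) (j m : ℕ) (hm : ¬ 2 ∣ m) :
    ((X ^ 2 + C a : ℂ[X]) ^ j).coeff m = 0 := by
  have : (X ^ 2 + C a : ℂ[X]) ^ j = expand ℂ 2 ((X + C a) ^ j) := by simp
  rw [this, coeff_expand (by norm_num), if_neg hm]

open Polynomial in
theorem aux_coeff (a b : ℂ) (ν : ℕ) :
    ((C b * X + (X ^ 2 + C a) : ℂ[X]) ^ (2 * ν)).coeff (2 * ν) =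
      ∑ μ ∈ Finset.range (ν + 1), (((2 * ν).choose (2 * μ) * (2 * (ν - μ)).choose (ν - μ) : ℕ) : ℂ)
        * b ^ (2 * μ) * a ^ (ν - μ) := by
  rw [add_pow, finsetSum_coeff]
  have key : ∀ k ∈ Finset.range (2 * ν + 1),
      ((C b * X) ^ k * (X ^ 2 + C a : ℂ[X]) ^ (2 * ν - k) * ((2 * ν).choose k : ℂ[X])).coeff (2 * ν)
      = b ^ k * ((X ^ 2 + C a : ℂ[X]) ^ (2 * ν - k)).coeff (2 * ν - k) * ((2 * ν).choose k : ℂ) := by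
    intro k hk
    have hk' : k ≤ 2 * ν := by simp at hk; omega
    rw [← C_eq_natCast, coeff_mul_C, mul_pow, ← C_pow, mul_assoc, coeff_C_mul, coeff_X_pow_mul',
      if_pos hk']
  rw [Finset.sum_congr rfl key]
  symm
  refine Finset.sum_of_injOn (fun μ => 2 * μ) ?_ ?_ ?_ ?_
  · intro x _ y _ h
    simpa using h
  · intro x hx
    simp at hx ⊢
    omega
  · intro k hk hk'
    rw [aux_coeff_odd, mul_zero, zero_mul]
    rintro ⟨c, hc⟩
    apply hk'
    simp at hk
    exact ⟨k / 2, by simp; omega, by simp; omega⟩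
  · intro μ hμ
    have : 2 * ν - 2 * μ = 2 * (ν - μ) := by omega
    simp only [this, aux_coeff_even]
    push_cast
    ring

theorem aux_choose (ν μ : ℕ) (h : μ ≤ ν) :
    (((2 * ν).choose (2 * μ) * (2 * (ν - μ)).choose (ν - μ) : ℕ) : ℂ) =
    ((2 * ν).factorial : ℂ) /
      ((Nat.factorial (2 * μ) * (Nat.factorial (ν - μ) * Nat.factorial (ν - μ)) : ℕ) : ℂ) := by
  have h1 := Nat.choose_mul_factorial_mul_factorial (show 2 * μ ≤ 2 * ν by omega)
  have h2 := Nat.choose_mul_factorial_mul_factorial (show ν - μ ≤ 2 * (ν - μ) by omega)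
  rw [show 2 * (ν - μ) - (ν - μ) = ν - μ by omega] at h2
  rw [show 2 * ν - 2 * μ = 2 * (ν - μ) by omega, ← h2] at h1
  rw [eq_div_iff (Nat.cast_ne_zero.2 (by positivity)), ← h1]
  push_cast
  ring

open Polynomial in
theorem aux_eval (ν : ℕ) (z : ℂ) : ((Bnu ν).map (algebraMap ℚ ℂ)).eval z =
    ∑ μ ∈ Finset.range (ν + 1), (((2 * ν).choose (2 * μ) * (2 * (ν - μ)).choose (ν - μ) : ℕ) : ℂ)
        * z ^ μ := by
  rw [Bnu, Polynomial.map_sum, eval_finsetSum]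
  refine Finset.sum_congr rfl fun μ hμ => ?_
  rw [aux_choose ν μ (by simp at hμ; omega)]
  simp

open Polynomial in
theorem aux_deriv_eval (ν : ℕ) (x : ℂ) :
    (derivative^[2 * ν] ((X ^ 2 - 1 : ℂ[X]) ^ (2 * ν))).eval x = ((2 * ν).factorial : ℂ) *
      ((C (2 * x) * X + (X ^ 2 + C (x ^ 2 - 1)) : ℂ[X]) ^ (2 * ν)).coeff (2 * ν) := by
  rw [← factorial_smul_hasseDeriv]
  rw [LinearMap.smul_apply, eval_smul, ← taylor_coeff]
  simp only [nsmul_eq_mul]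
  congr 2
  rw [taylor_pow]
  congr 1
  simp only [map_sub, taylor_pow, taylor_X, taylor_one, map_mul, map_pow, map_one, map_ofNat]
  ring

/-- A nonnegative real root is impossible. -/
theorem aux_pos (ν : ℕ) (r : ℝ) (hr : 0 ≤ r) :
    (((Bnu ν).map (algebraMap ℚ ℂ)).eval (r : ℂ)) ≠ 0 := by
  rw [aux_eval]
  have : 0 < ∑ μ ∈ Finset.range (ν + 1),
      (((2 * ν).choose (2 * μ) * (2 * (ν - μ)).choose (ν - μ) : ℕ) : ℝ) * r ^ μ := by
    refine Finset.sum_pos' (fun μ _ => by positivity) ⟨0, by simp, ?_⟩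
    have := Nat.choose_pos (show ν ≤ 2 * ν by omega)
    simpa using this
  exact_mod_cast this.ne'

theorem aux_real (ν : ℕ) (hν : 1 ≤ ν) (z : ℂ)
    (hz : ((Bnu ν).map (algebraMap ℚ ℂ)).eval z = 0) : z.im = 0 ∧ z.re < 0 := by
  have him : z.im = 0 := by
    have h4 : z - 4 ≠ 0 := by
      intro h
      have : z = ((4 : ℝ) : ℂ) := by push_cast; linear_combination h
      rw [this] at hz
      exact aux_pos ν 4 (by norm_num) hz
    obtain ⟨ζ, hζ'⟩ := IsAlgClosed.exists_pow_nat_eq z (n := 2) (by norm_num)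
    have hζ := hζ'.symm
    obtain ⟨c, hc'⟩ := IsAlgClosed.exists_pow_nat_eq (4 / (z - 4)) (n := 2) (by norm_num)
    have hc := hc'.symm
    have hc4 : c ^ 2 * (z - 4) = 4 := by rw [← hc]; field_simp
    have hx1 : (c * ζ / 2) ^ 2 - 1 = c ^ 2 := by
      linear_combination hc4 / 4 - c ^ 2 / 4 * hζ
    have hx : (c * ζ / 2).im = 0 := by
      apply aux_legendre (2 * ν) (by omega)
      rw [aux_deriv_eval, aux_coeff, hx1]
      have : ∑ μ ∈ Finset.range (ν + 1),
          (((2 * ν).choose (2 * μ) * (2 * (ν - μ)).choose (ν - μ) : ℕ) : ℂ)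
          * (2 * (c * ζ / 2)) ^ (2 * μ) * (c ^ 2) ^ (ν - μ) =
          (c ^ 2) ^ ν * ((Bnu ν).map (algebraMap ℚ ℂ)).eval z := by
        rw [aux_eval, Finset.mul_sum]
        refine Finset.sum_congr rfl fun μ hμ => ?_
        obtain ⟨k, rfl⟩ : ∃ k, ν = μ + k := ⟨ν - μ, by simp at hμ; omega⟩
        rw [hζ, Nat.add_sub_cancel_left]
        ring
      rw [this, hz]; simp
    set x := c * ζ / 2 with hxdef
    have hxr : x = (x.re : ℂ) := by
      apply Complex.ext <;> simp [hx]
    have hfin : z = ((x.re ^ 2 : ℝ) : ℂ) * (z - 4) := by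
      push_cast
      rw [← hxr]
      have : x ^ 2 = c ^ 2 + 1 := by linear_combination hx1
      rw [this]; linear_combination -hc4
    have e1 := congrArg Complex.re hfin
    have e2 := congrArg Complex.im hfin
    rw [Complex.re_ofReal_mul] at e1
    rw [Complex.im_ofReal_mul] at e2
    simp at e1 e2
    by_contra hne
    have : x.re ^ 2 = 1 := by
      apply mul_right_cancel₀ hne
      linarith
    rw [this] at e1
    linarith
  refine ⟨him, ?_⟩
  by_contra h
  push Not at h
  have : z = (z.re : ℂ) := by apply Complex.ext <;> simp [him]
  rw [this] at hz
  exact aux_pos ν _ h hz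

open Polynomial in
theorem aux_Bcoeff (ν μ : ℕ) : (Bnu ν).coeff μ = if μ ≤ ν then ((2 * ν).factorial : ℚ) /
      ((Nat.factorial (2 * μ) * (Nat.factorial (ν - μ) * Nat.factorial (ν - μ)) : ℕ) : ℚ) else 0 := by
  rw [Bnu, finsetSum_coeff]
  simp only [coeff_C_mul_X_pow]
  rw [Finset.sum_ite_eq]
  simp

theorem aux_rec (ν μ : ℕ) : ((ν : ℚ) - μ) ^ 2 * (Bnu ν).coeff μ =
    (2 * μ + 2) * (2 * μ + 1) * (Bnu ν).coeff (μ + 1) := by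
  rw [aux_Bcoeff, aux_Bcoeff]
  rcases lt_trichotomy μ ν with h | h | h
  · obtain ⟨k, rfl⟩ : ∃ k, ν = μ + 1 + k := ⟨ν - (μ + 1), by omega⟩
    rw [if_pos (by omega), if_pos (by omega), show μ + 1 + k - μ = k + 1 by omega,
      show μ + 1 + k - (μ + 1) = k by omega, show 2 * (μ + 1) = 2 * μ + 1 + 1 by ring,
      Nat.factorial_succ (2 * μ + 1), Nat.factorial_succ (2 * μ), Nat.factorial_succ k]
    push_cast
    have := Nat.factorial_pos k
    have := Nat.factorial_pos (2 * μ)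
    field_simp
    ring
  · subst h; simp
  · rw [if_neg (by omega), if_neg (by omega)]; simp

open Polynomial in
theorem aux_ode (ν : ℕ) : X * (X - 4) * derivative (derivative (Bnu ν)) =
    (C (2 * ν - 1 : ℚ) * X + 2) * derivative (Bnu ν) - C ((ν : ℚ) ^ 2) * Bnu ν := by
  ext μ
  have h := aux_rec ν μ
  have e : X * (X - 4) * derivative (derivative (Bnu ν)) =
    X * (X * derivative (derivative (Bnu ν))) - C 4 * (X * derivative (derivative (Bnu ν))) := by
    simp only [map_ofNat]; ring
  have e' : (C (2 * ν - 1 : ℚ) * X + 2) * derivative (Bnu ν) - C ((ν : ℚ) ^ 2) * Bnu ν =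
    C (2 * ν - 1 : ℚ) * (X * derivative (Bnu ν)) + C 2 * derivative (Bnu ν)
      - C ((ν : ℚ) ^ 2) * Bnu ν := by
    simp only [map_ofNat]; ring
  rw [e, e']
  simp only [coeff_sub, coeff_add, coeff_C_mul]
  rcases μ with _ | _ | μ
  · simp [coeff_derivative] at h ⊢
    linarith only [h]
  · simp [coeff_derivative, coeff_X_mul] at h ⊢
    linarith only [h]
  · simp [coeff_derivative, coeff_X_mul] at h ⊢
    linarith

open Polynomial in
theorem aux_simple (ν : ℕ) (hν : 1 ≤ ν) (a : ℂ) :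
    ((Bnu ν).map (algebraMap ℚ ℂ)).rootMultiplicity a ≤ 1 := by
  set B := (Bnu ν).map (algebraMap ℚ ℂ) with hB
  have hode : X * (X - 4) * derivative (derivative B) =
    (C (2 * ν - 1 : ℂ) * X + 2) * derivative B - C ((ν : ℂ) ^ 2) * B := by
    have := congrArg (Polynomial.map (algebraMap ℚ ℂ)) (aux_ode ν)
    simpa [hB, derivative_map] using this
  by_contra hm
  push Not at hm
  have hroot : B.IsRoot a := (rootMultiplicity_pos'.1 (by omega)).2
  have hd := derivative_rootMultiplicity_of_root hroot
  have hroot1 := (rootMultiplicity_pos'.1 (show 0 < (derivative B).rootMultiplicity a by omega))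
  have hd2 := derivative_rootMultiplicity_of_root hroot1.2
  have hne : derivative (derivative B) ≠ 0 := by
    intro h0
    have h1 := derivative_eq_zero.1 h0
    obtain ⟨c, hc⟩ := natDegree_eq_zero.1 h1
    have h2 := hroot1.2
    rw [← hc] at h2
    simp at h2
    apply hroot1.1
    rw [← hc, h2, C_0]
  obtain ⟨him, hre⟩ := aux_real ν hν a hroot
  have hdvd : (X - C a) ^ (B.rootMultiplicity a - 1) ∣ X * (X - 4) * derivative (derivative B) := by
    rw [hode]
    refine dvd_sub (Dvd.dvd.mul_left ?_ _) (Dvd.dvd.mul_left ?_ _)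
    · rw [← hd]; exact pow_rootMultiplicity_dvd _ _
    · exact (pow_dvd_pow _ (Nat.sub_le _ _)).trans (pow_rootMultiplicity_dvd _ _)
  have hX0 : (X * (X - 4) : ℂ[X]).rootMultiplicity a = 0 := by
    apply rootMultiplicity_eq_zero
    intro h
    simp at h
    rcases h with h | h
    · rw [h] at hre; simp at hre
    · have : a = 4 := by linear_combination h
      rw [this] at hre; norm_num at hre
  have hXne : (X * (X - 4) : ℂ[X]) ≠ 0 := by
    refine mul_ne_zero X_ne_zero ?_
    exact X_sub_C_ne_zero (4 : ℂ)
  have hne' := mul_ne_zero hXne hne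
  have := (le_rootMultiplicity_iff hne').2 hdvd
  rw [rootMultiplicity_mul hne'] at this
  omega

/-- For every `ν ≥ 1`, the polynomial `B_ν` has exactly `ν` roots, and all of its roots
are real, negative, and simple. -/
theorem stmt5 (ν : ℕ) (hν : 1 ≤ ν) :
    ((Bnu ν).map (algebraMap ℚ ℂ)).roots.card = ν ∧
    ((Bnu ν).map (algebraMap ℚ ℂ)).roots.Nodup ∧
    ∀ z ∈ ((Bnu ν).map (algebraMap ℚ ℂ)).roots, z.im = 0 ∧ z.re < 0 := by
  refine ⟨?_, ?_, ?_⟩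
  · rw [Polynomial.splits_iff_card_roots.1 (IsAlgClosed.splits _), Polynomial.natDegree_map]
    apply Polynomial.natDegree_eq_of_le_of_coeff_ne_zero
    · rw [Polynomial.natDegree_le_iff_coeff_eq_zero]
      intro N hN
      rw [aux_Bcoeff, if_neg (by omega)]
    · rw [aux_Bcoeff, if_pos le_rfl]
      positivity
  · rw [Multiset.nodup_iff_count_le_one]
    intro a
    rw [Polynomial.count_roots]
    exact aux_simple ν hν a
  · intro z hz
    exact aux_real ν hν z (Polynomial.isRoot_of_mem_roots hz)
end

section
/- For every integer ν ≥ 1, the polynomial Q̂_ν has degree ν, all of its roots are real and simple, exactly one root is positive, and the remaining ν − 1 roots are negative. Moreover the negative roots of Q̂_ν interlace the (all negative) roots of B_ν: exactly one root of Q̂_ν lies in each open interval between consecutive roots of B_ν. -/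
/-- `Q̂_ν(y) = Σ_{μ=0}^{ν} [(2ν)!/((2μ)!·((ν−μ)!)²) − (2ν)!/((2μ−1)!·(ν−μ)!·(ν−μ+1)!)]·y^μ`
(the second term absent for `μ = 0`), so that `Q̂_ν(ζ²) = S_{2ν}(ζ) − ζ·R_{2ν}′(ζ)`. -/
noncomputable def Qnu (ν : ℕ) : Polynomial ℚ :=
  ∑ μ ∈ Finset.range (ν + 1),
    Polynomial.C ((((2 * ν).factorial : ℚ) /
        ((Nat.factorial (2 * μ) * (Nat.factorial (ν - μ) * Nat.factorial (ν - μ)) : ℕ) : ℚ)) -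
      (if μ = 0 then 0 else
        ((2 * ν).factorial : ℚ) /
        ((Nat.factorial (2 * μ - 1) * (Nat.factorial (ν - μ) * Nat.factorial (ν - μ + 1)) : ℕ) : ℚ))) *
      Polynomial.X ^ μ

open Polynomial in
lemma Bnu_coeff (ν k : ℕ) : (Bnu ν).coeff k = if k ≤ ν then (((2 * ν).factorial : ℚ) /
      ((Nat.factorial (2 * k) * (Nat.factorial (ν - k) * Nat.factorial (ν - k)) : ℕ) : ℚ)) else 0 := by
  simp only [Bnu, finsetSum_coeff, coeff_C_mul_X_pow, Finset.sum_ite_eq, Finset.mem_range, Nat.lt_succ_iff]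

open Polynomial in
lemma Qnu_coeff (ν k : ℕ) : (Qnu ν).coeff k = if k ≤ ν then ((((2 * ν).factorial : ℚ) /
        ((Nat.factorial (2 * k) * (Nat.factorial (ν - k) * Nat.factorial (ν - k)) : ℕ) : ℚ)) -
      (if k = 0 then 0 else
        ((2 * ν).factorial : ℚ) /
        ((Nat.factorial (2 * k - 1) * (Nat.factorial (ν - k) * Nat.factorial (ν - k + 1)) : ℕ) : ℚ))) else 0 := by
  simp only [Qnu, finsetSum_coeff, coeff_C_mul_X_pow, Finset.sum_ite_eq, Finset.mem_range, Nat.lt_succ_iff]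

open Polynomial in
lemma Bnu_rec (ν : ℕ) : C (((ν:ℚ)+1)*(2*ν+1)) * Bnu (ν+1) =
    C (((ν:ℚ)+1)*(2*ν+1)+(4*ν+3)*ν) * (X * Bnu ν) + C (2*(2*(ν:ℚ)+1)^2) * Bnu ν
     - C (4*(ν:ℚ)+3) * (X * (X * derivative (Bnu ν))) + C (4*(4*(ν:ℚ)+3)) * (X * derivative (Bnu ν)) := by
  ext k
  simp only [coeff_add, coeff_sub, coeff_C_mul]
  rcases k with _ | k
  · simp only [coeff_X_mul_zero, Bnu_coeff]
    simp [show 2*(ν+1) = 2*ν+1+1 by ring, Nat.factorial_succ]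
    field_simp
    ring
  · simp only [coeff_X_mul]
    have hX : (X * derivative (Bnu ν)).coeff k = k * (Bnu ν).coeff k := by
      rcases k with _ | k
      · simp
      · rw [coeff_X_mul, coeff_derivative]; push_cast; ring
    rw [hX, coeff_derivative]
    simp only [Bnu_coeff]
    rcases lt_trichotomy k ν with h | h | h
    · obtain ⟨j, rfl⟩ := Nat.exists_eq_add_of_lt h
      rw [if_pos (by omega), if_pos (by omega), if_pos (by omega)]
      simp only [show 2*(k+j+1+1) = 2*(k+j+1)+1+1 by ring, show 2*(k+1) = 2*k+1+1 by ring,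
        show k + j + 1 + 1 - (k+1) = j+1 by omega, show k + j + 1 - k = j+1 by omega,
        show k + j + 1 - (k+1) = j by omega, Nat.factorial_succ]
      push_cast
      have h1 := (Nat.factorial_pos j).ne'
      have h2 := (Nat.factorial_pos (2*k)).ne'
      field_simp
      ring
    · subst h
      simp
      simp only [show 2*(k+1) = 2*k+1+1 by ring, Nat.factorial_succ]
      push_cast
      field_simp
      ring
    · rw [if_neg (by omega), if_neg (by omega), if_neg (by omega)]
      simp

open Polynomial in
lemma Qnu_rel (ν : ℕ) : C (2*(ν:ℚ)+1) * Qnu ν = C (2*(ν:ℚ)+1) * Bnu ν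
     - C (ν:ℚ) * (X * Bnu ν) + X * (X * derivative (Bnu ν)) - C 4 * (X * derivative (Bnu ν)) := by
  ext k
  simp only [coeff_add, coeff_sub, coeff_C_mul]
  rcases k with _ | k
  · simp [coeff_X_mul_zero, Bnu_coeff, Qnu_coeff]
  · simp only [coeff_X_mul]
    have hX : (X * derivative (Bnu ν)).coeff k = k * (Bnu ν).coeff k := by
      rcases k with _ | k
      · simp
      · rw [coeff_X_mul, coeff_derivative]; push_cast; ring
    rw [hX, coeff_derivative]
    simp only [Bnu_coeff, Qnu_coeff]
    rcases lt_trichotomy k ν with h | h | h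
    · obtain ⟨j, rfl⟩ := Nat.exists_eq_add_of_lt h
      simp only [if_pos (show k + 1 ≤ k + j + 1 by omega), if_pos (show k ≤ k + j + 1 by omega),
        if_neg (Nat.succ_ne_zero k)]
      rw [show 2*(k+1) - 1 = 2*k+1 by omega]
      simp only [show 2*(k+1) = 2*k+1+1 by ring,
        show k + j + 1 - k = j+1 by omega,
        show k + j + 1 - (k+1) = j by omega, Nat.factorial_succ]
      push_cast
      have h1 := (Nat.factorial_pos j).ne'
      have h2 := (Nat.factorial_pos (2*k)).ne'
      field_simp
      ring
    · subst h
      simp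
    · rw [if_neg (by omega), if_neg (by omega), if_neg (by omega)]
      simp

noncomputable def Br (ν : ℕ) : Polynomial ℝ := (Bnu ν).map (algebraMap ℚ ℝ)
noncomputable def Qr (ν : ℕ) : Polynomial ℝ := (Qnu ν).map (algebraMap ℚ ℝ)

open Polynomial in
lemma Bnu_natDegree (ν : ℕ) : (Bnu ν).natDegree = ν := by
  apply natDegree_eq_of_le_of_coeff_ne_zero
  · rw [natDegree_le_iff_coeff_eq_zero]
    intro N hN
    rw [Bnu_coeff, if_neg (by omega)]
  · rw [Bnu_coeff, if_pos le_rfl]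
    positivity

lemma Bnu_lead (ν : ℕ) : (Bnu ν).coeff ν = 1 := by
  rw [Bnu_coeff, if_pos le_rfl]
  have : ((2 * ν).factorial : ℚ) ≠ 0 := by positivity
  simp [this]

lemma Qnu_lead (ν : ℕ) (hν : 1 ≤ ν) : (Qnu ν).coeff ν < 0 := by
  obtain ⟨n, rfl⟩ : ∃ n, ν = n + 1 := ⟨ν-1, by omega⟩
  rw [Qnu_coeff, if_pos le_rfl, if_neg (by omega)]
  rw [show 2*(n+1) - 1 = 2*n+1 by omega]
  simp only [show 2*(n+1) = 2*n+1+1 by ring, Nat.factorial_succ]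
  simp
  field_simp
  have : (0:ℚ) ≤ n := by positivity
  linarith

open Polynomial in
lemma Qnu_natDegree (ν : ℕ) (hν : 1 ≤ ν) : (Qnu ν).natDegree = ν := by
  apply natDegree_eq_of_le_of_coeff_ne_zero
  · rw [natDegree_le_iff_coeff_eq_zero]
    intro N hN
    rw [Qnu_coeff, if_neg (by omega)]
  · exact (Qnu_lead ν hν).ne

lemma Br_natDegree (ν : ℕ) : (Br ν).natDegree = ν := by
  rw [Br, Polynomial.natDegree_map, Bnu_natDegree]
lemma Br_lead (ν : ℕ) : (Br ν).leadingCoeff = 1 := by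
  rw [Polynomial.leadingCoeff, Br_natDegree, Br, Polynomial.coeff_map, Bnu_lead]; simp
lemma Qr_natDegree (ν : ℕ) (hν : 1 ≤ ν) : (Qr ν).natDegree = ν := by
  rw [Qr, Polynomial.natDegree_map, Qnu_natDegree ν hν]
lemma Qr_lead (ν : ℕ) (hν : 1 ≤ ν) : (Qr ν).leadingCoeff < 0 := by
  rw [Polynomial.leadingCoeff, Qr_natDegree ν hν, Qr, Polynomial.coeff_map]
  simpa using Qnu_lead ν hν

lemma Br_zero (ν : ℕ) : 0 < (Br ν).eval 0 := by
  rw [← Polynomial.coeff_zero_eq_eval_zero, Br, Polynomial.coeff_map, Bnu_coeff]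
  simp
  positivity

open Polynomial in
lemma Br_rec (ν : ℕ) (y : ℝ) (h : (Br ν).eval y = 0) : (((ν:ℝ)+1)*(2*ν+1)) * (Br (ν+1)).eval y =
    - ((4*(ν:ℝ)+3) * (y * (y - 4)) * (derivative (Br ν)).eval y) := by
  have := congrArg (fun p => (p.map (algebraMap ℚ ℝ)).eval y) (Bnu_rec ν)
  simp only [Polynomial.map_add, Polynomial.map_sub, Polynomial.map_mul, map_C, map_X,
    eval_add, eval_sub, eval_mul, eval_C, eval_X, ← derivative_map] at this
  simp only [← Br.eq_1, h] at this
  simp at this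
  linarith

open Polynomial in
lemma Qr_rel (ν : ℕ) (y : ℝ) : (2*(ν:ℝ)+1) * (Qr ν).eval y =
    (2*(ν:ℝ)+1 - ν * y) * (Br ν).eval y +  (y * (y - 4)) * (derivative (Br ν)).eval y := by
  have := congrArg (fun p => (p.map (algebraMap ℚ ℝ)).eval y) (Qnu_rel ν)
  simp only [Polynomial.map_add, Polynomial.map_sub, Polynomial.map_mul, map_C, map_X,
    eval_add, eval_sub, eval_mul, eval_C, eval_X, ← derivative_map] at this
  simp only [← Br.eq_1, ← Qr.eq_1] at this
  simp at this
  linarith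

/-- intermediate value theorem for alternating signs -/
lemma ivt_alt (F : Polynomial ℝ) (n : ℕ) (t : ℕ → ℝ) (ht : ∀ i < n, t (i+1) < t i)
    (hs : ∀ i ≤ n, 0 < (-1)^i * F.eval (t i)) :
    ∃ s : ℕ → ℝ, ∀ i < n, t (i+1) < s i ∧ s i < t i ∧ F.eval (s i) = 0 := by
  have : ∀ i, ∃ s : ℝ, i < n → t (i+1) < s ∧ s < t i ∧ F.eval s = 0 := by
    intro i
    by_cases hi : i < n
    · have h1 := hs i hi.le
      have h2 := hs (i+1) hi
      have hc : ContinuousOn (fun x => (-1)^i * F.eval x) (Set.Icc (t (i+1)) (t i)) := by fun_prop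
      have := intermediate_value_Ioo (ht i hi).le hc
      have h0 : (0:ℝ) ∈ Set.Ioo ((-1)^i * F.eval (t (i+1))) ((-1)^i * F.eval (t i)) := by
        refine ⟨?_, h1⟩
        rw [pow_succ] at h2
        linarith
      obtain ⟨s, ⟨h3, h4⟩, h5⟩ := this h0
      exact ⟨s, fun _ => ⟨h3, h4, by simpa using h5⟩⟩
    · exact ⟨0, fun h => absurd h hi⟩
  choose s hs using this
  exact ⟨s, hs⟩

lemma anti_of_step (n : ℕ) (t : ℕ → ℝ) (ht : ∀ i, i + 1 < n → t (i+1) < t i) :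
    ∀ i j, i < j → j < n → t j < t i := by
  intro i j hij
  induction j, hij using Nat.le_induction with
  | base => exact fun h => ht i h
  | succ j hj ih => exact fun h => (ht j h).trans (ih (by omega))

lemma roots_eq {K : Type*} [Field K] (F : Polynomial K) (hF : F ≠ 0) (n : ℕ) (hd : F.natDegree = n)
    (r : ℕ → K) (hr : Set.InjOn r (Finset.range n)) (h0 : ∀ i < n, F.eval (r i) = 0) :
    F.roots = (Finset.range n).val.map r := by
  symm
  apply Multiset.eq_of_le_of_card_le
  · rw [Multiset.le_iff_subset]
    · intro x hx
      simp only [Multiset.mem_map, Finset.mem_val, Finset.mem_range] at hx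
      obtain ⟨i, hi, rfl⟩ := hx
      rw [Polynomial.mem_roots hF]
      exact h0 i hi
    · exact Multiset.Nodup.map_on (fun x hx y hy h => hr hx hy h) (Finset.range n).nodup
  · rw [Multiset.card_map]
    simpa [hd] using Polynomial.card_roots' F

lemma injOn_of_anti (n : ℕ) (r : ℕ → ℝ) (hr : ∀ i j, i < j → j < n → r j < r i) :
    Set.InjOn r (Finset.range n) := by
  intro i hi j hj h
  simp at hi hj
  rcases lt_trichotomy i j with h1 | h1 | h1
  · exact absurd h (hr i j h1 hj).ne'
  · exact h1
  · exact absurd h (hr j i h1 hi).ne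

open Polynomial in
lemma deriv_sign (F : Polynomial ℝ) (n : ℕ) (hd : F.natDegree = n) (hl : F.leadingCoeff = 1)
    (r : ℕ → ℝ) (hr : ∀ i j, i < j → j < n → r j < r i) (h0 : ∀ i < n, F.eval (r i) = 0) :
    ∀ i < n, 0 < (-1)^i * (derivative F).eval (r i) := by
  intro i hi
  have hF : F ≠ 0 := by rintro rfl; simp at hl
  have hro := roots_eq F hF n hd r (injOn_of_anti n r hr) h0
  have hprod : F = Lagrange.nodal (Finset.range n) r := by
    have h := Polynomial.prod_multiset_X_sub_C_of_monic_of_roots_card_eq (p := F) hl (by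
      rw [hro, hd]; simp)
    rw [← h, hro, Lagrange.nodal, Multiset.map_map]
    rfl
  rw [hprod, Lagrange.eval_nodal_derivative_eval_node_eq (by simpa using hi), Lagrange.eval_nodal]
  have h1 : ((-1:ℝ))^i = ∏ j ∈ (Finset.range n).erase i, (if j < i then (-1) else 1) := by
    rw [Finset.prod_ite]
    simp only [Finset.prod_const_one, mul_one, Finset.prod_const]
    congr 1
    have : ((Finset.range n).erase i).filter (· < i) = Finset.range i := by
      ext j; simp; omega
    rw [this, Finset.card_range]
  rw [h1, ← Finset.prod_mul_distrib]
  apply Finset.prod_pos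
  intro j hj
  simp at hj
  split_ifs with h
  · have := hr j i h hi; linarith
  · have := hr i j (by omega) hj.2; linarith

open Polynomial Filter in
lemma exists_large (F : Polynomial ℝ) (hd : 0 < F.natDegree) (hl : 0 < F.leadingCoeff) (M : ℝ) :
    ∃ x, M < x ∧ 0 < F.eval x := by
  have := Polynomial.tendsto_atTop_of_leadingCoeff_nonneg F (natDegree_pos_iff_degree_pos.1 hd) hl.le
  obtain ⟨x, h1, h2⟩ := ((this.eventually (eventually_gt_atTop 0)).and (eventually_gt_atTop M)).exists
  exact ⟨x, h2, h1⟩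

open Polynomial in
lemma exists_small (F : Polynomial ℝ) (hd : 0 < F.natDegree) (hl : F.leadingCoeff = 1) (M : ℝ) :
    ∃ x, x < M ∧ 0 < (-1)^F.natDegree * F.eval x := by
  obtain ⟨x, h1, h2⟩ := exists_large (C ((-1)^F.natDegree) * F.comp (-X))
    (by rw [natDegree_C_mul (by simp), natDegree_comp]; simpa using hd)
    (by rw [leadingCoeff_mul, leadingCoeff_comp (by simp), leadingCoeff_C, hl]
        simp [← mul_pow]) (-M)
  refine ⟨-x, by linarith, ?_⟩
  simpa using h2

lemma Br_roots (ν : ℕ) : ∃ r : ℕ → ℝ, (∀ i j, i < j → j < ν → r j < r i) ∧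
    (∀ i < ν, (Br ν).eval (r i) = 0) ∧ (∀ i < ν, r i < 0) := by
  induction ν with
  | zero => exact ⟨0, by simp, by simp, by simp⟩
  | succ ν ih =>
    obtain ⟨r, hr, h0, hn⟩ := ih
    have hsg := deriv_sign (Br ν) ν (Br_natDegree ν) (Br_lead ν) r hr h0
    let t0 : ℕ → ℝ := fun i => if i = 0 then 0 else r (i-1)
    obtain ⟨m, hm1, hm2⟩ := exists_small (Br (ν+1)) (by rw [Br_natDegree]; omega) (Br_lead _) (t0 ν)
    rw [Br_natDegree] at hm2
    let t : ℕ → ℝ := fun i => if i = ν + 1 then m else t0 i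
    have ht : ∀ i < ν+1, t (i+1) < t i := by
      intro i hi
      rcases (Nat.lt_succ_iff.1 hi).eq_or_lt with h | h
      · subst h; simp only [t]; simpa using hm1
      · simp only [t, t0]
        rw [if_neg (by omega), if_neg (by omega), if_neg (by omega)]
        split_ifs with h1
        · exact hn _ (by omega)
        · exact hr _ _ (by omega) (by omega)
    obtain ⟨s, hs⟩ := ivt_alt (Br (ν+1)) (ν+1) t ht (by
      intro i hi
      simp only [t]
      split_ifs with h1
      · subst h1; exact hm2
      · rcases i with _ | i
        · simpa [t0] using Br_zero (ν+1)
        · have hi' : i < ν := by omega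
          simp only [t0, Nat.add_sub_cancel, if_neg (Nat.succ_ne_zero i)]
          have e := Br_rec ν (r i) (h0 i hi')
          have p := hsg i hi'
          have q := hn i hi'
          have c1 : (0:ℝ) < ((ν:ℝ)+1)*(2*ν+1) := by positivity
          have c2 : (0:ℝ) < (4*(ν:ℝ)+3) * (r i * (r i - 4)) := by
            have : 0 < r i * (r i - 4) := mul_pos_of_neg_of_neg q (by linarith)
            positivity
          have := mul_pos c2 p
          have h3 : 0 < (((ν:ℝ)+1)*(2*ν+1)) * ((-1)^(i+1) * Polynomial.eval (r i) (Br (ν+1))) := by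
            calc _ < _ := this
              _ = (-1)^(i+1) * ((((ν:ℝ)+1)*(2*ν+1)) * Polynomial.eval (r i) (Br (ν+1))) := by
                rw [e, pow_succ]; ring
              _ = _ := by ring
          exact (mul_pos_iff_of_pos_left c1).1 h3)
    refine ⟨s, anti_of_step _ _ ?_, fun i hi => (hs i hi).2.2, ?_⟩
    · intro i hi
      exact (hs (i+1) hi).2.1.trans (hs i (by omega)).1
    · intro i hi
      have h1 := (hs i hi).2.1
      rcases i with _ | i
      · simpa [t, t0] using h1
      · refine h1.trans ?_
        simp only [t, t0]
        rw [if_neg (by omega), if_neg (by omega)]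
        exact hn _ (by omega)

lemma Qr_roots (ν : ℕ) (hν : 1 ≤ ν) : ∃ r s : ℕ → ℝ, (∀ i j, i < j → j < ν → r j < r i) ∧
    (∀ i < ν, (Br ν).eval (r i) = 0) ∧ (∀ i < ν, r i < 0) ∧
    (∀ i < ν, (Qr ν).eval (s i) = 0) ∧ 0 < s 0 ∧
    (∀ i, i + 1 < ν → r (i+1) < s (i+1) ∧ s (i+1) < r i) := by
  obtain ⟨r, hr, h0, hn⟩ := Br_roots ν
  have hsg := deriv_sign (Br ν) ν (Br_natDegree ν) (Br_lead ν) r hr h0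
  obtain ⟨M, hM, hM'⟩ := exists_large (-(Qr ν))
    (by rw [Polynomial.natDegree_neg, Qr_natDegree ν hν]; omega)
    (by rw [Polynomial.leadingCoeff_neg]; have := Qr_lead ν hν; linarith) 0
  have hQ0 : 0 < (Qr ν).eval 0 := by
    have := Qr_rel ν 0
    simp at this
    have c : (0:ℝ) < 2 * ν + 1 := by positivity
    rcases this with h | h
    · rw [h]; exact Br_zero ν
    · linarith
  obtain ⟨p, ⟨hp1, hp2⟩, hp⟩ := intermediate_value_Ioo' (f := fun x => (Qr ν).eval x) hM.le
    (by fun_prop) (show (0:ℝ) ∈ Set.Ioo _ _ from ⟨by simpa using hM', hQ0⟩)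
  obtain ⟨s, hs⟩ := ivt_alt (Qr ν) (ν-1) r (fun i hi => hr _ _ (by omega) (by omega)) (by
    intro i hi
    have hi' : i < ν := by omega
    have e := Qr_rel ν (r i)
    rw [h0 i hi'] at e
    have q := hn i hi'
    have c1 : (0:ℝ) < 2*ν+1 := by positivity
    have c2 : 0 < r i * (r i - 4) := mul_pos_of_neg_of_neg q (by linarith)
    have := mul_pos c2 (hsg i hi')
    have h3 : 0 < ((2*ν+1):ℝ) * ((-1)^i * Polynomial.eval (r i) (Qr ν)) := by
      calc _ < _ := this
        _ = (-1)^i * ((2*ν+1) * Polynomial.eval (r i) (Qr ν)) := by rw [e]; ring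
        _ = _ := by ring
    exact (mul_pos_iff_of_pos_left c1).1 h3)
  refine ⟨r, fun i => if i = 0 then p else s (i-1), hr, h0, hn, ?_, by simpa using hp1, ?_⟩
  · intro i hi
    by_cases h : i = 0
    · simp only [h, if_true]; exact hp
    · simp only [h, if_false]; exact (hs (i-1) (by omega)).2.2
  · intro i hi
    simp only [Nat.succ_ne_zero, if_false, Nat.add_sub_cancel]
    have := hs i (by omega)
    exact ⟨this.1, this.2.1⟩

open scoped Classical in
/-- For every `ν ≥ 1`: `Q̂_ν` has degree `ν`, all of its roots are real and simple, exactly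
one root is positive and the remaining `ν − 1` roots are negative; moreover the negative
roots of `Q̂_ν` interlace the (all negative) roots of `B_ν`: exactly one root of `Q̂_ν` lies
in each open interval between consecutive roots of `B_ν`. -/
theorem stmt6 (ν : ℕ) (hν : 1 ≤ ν) :
    (Qnu ν).natDegree = ν ∧
    ((Qnu ν).map (algebraMap ℚ ℂ)).roots.card = ν ∧
    ((Qnu ν).map (algebraMap ℚ ℂ)).roots.Nodup ∧
    (∀ z ∈ ((Qnu ν).map (algebraMap ℚ ℂ)).roots, z.im = 0) ∧
    (((Qnu ν).map (algebraMap ℚ ℂ)).roots.filter (fun z => 0 < z.re)).card = 1 ∧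
    (((Qnu ν).map (algebraMap ℚ ℂ)).roots.filter (fun z => z.re < 0)).card = ν - 1 ∧
    (∀ a b : ℝ, a < b →
      Polynomial.aeval a (Bnu ν) = 0 → Polynomial.aeval b (Bnu ν) = 0 →
      (∀ x ∈ Set.Ioo a b, Polynomial.aeval x (Bnu ν) ≠ 0) →
      ∃! c : ℝ, c ∈ Set.Ioo a b ∧ Polynomial.aeval c (Qnu ν) = 0) := by
  obtain ⟨r, s, hr, hB, hn, hQ, hp, hs⟩ := Qr_roots ν hν
  have hsneg : ∀ i, i ≠ 0 → i < ν → s i < 0 := by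
    intro i h0 hi
    obtain ⟨k, rfl⟩ := Nat.exists_eq_succ_of_ne_zero h0
    exact (hs k hi).2.trans (hn k (by omega))
  have hsa : ∀ i j, i < j → j < ν → s j < s i := by
    apply anti_of_step
    intro i hi
    rcases i with _ | i
    · exact (hsneg 1 (by omega) hi).trans hp
    · exact (hs (i+1) hi).2.trans (hs i (by omega)).1
  have hinj := injOn_of_anti ν s hsa
  have hrootsR : (Qr ν).roots = (Finset.range ν).val.map s := by
    apply roots_eq _ _ _ (Qr_natDegree ν hν) _ hinj hQ
    intro h
    have := Qr_lead ν hν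
    simp [h] at this
  have hBroots : (Br ν).roots = (Finset.range ν).val.map r := by
    apply roots_eq _ _ _ (Br_natDegree ν) _ (injOn_of_anti ν r hr) hB
    intro h
    have := Br_lead ν
    simp [h] at this
  have hQC : (Qnu ν).map (algebraMap ℚ ℂ) = (Qr ν).map (algebraMap ℝ ℂ) := by
    rw [Qr, Polynomial.map_map]
    congr 1
  have hroots : ((Qnu ν).map (algebraMap ℚ ℂ)).roots = (Finset.range ν).val.map (fun i => (s i : ℂ)) := by
    apply roots_eq
    · intro h
      have h1 := congrArg Polynomial.natDegree h
      rw [Polynomial.natDegree_map, Qnu_natDegree ν hν] at h1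
      simp at h1; omega
    · rw [Polynomial.natDegree_map, Qnu_natDegree ν hν]
    · intro i hi j hj h
      simp only at h
      exact hinj hi hj (by exact_mod_cast h)
    · intro i hi
      rw [hQC]
      have := Polynomial.eval_map_algebraMap (B := ℂ) (Qr ν) ((s i : ℂ))
      rw [this]
      have h2 := Polynomial.aeval_algebraMap_apply ℂ (s i) (Qr ν)
      simp only [Complex.coe_algebraMap] at h2
      rw [h2]
      simp [hQ i hi]
  have aB : ∀ x : ℝ, Polynomial.aeval x (Bnu ν) = (Br ν).eval x := fun x => by
    rw [Br, Polynomial.eval_map_algebraMap]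
  have aQ : ∀ x : ℝ, Polynomial.aeval x (Qnu ν) = (Qr ν).eval x := fun x => by
    rw [Qr, Polynomial.eval_map_algebraMap]
  have memB : ∀ x : ℝ, (Br ν).eval x = 0 → ∃ i < ν, r i = x := by
    intro x hx
    have : x ∈ (Br ν).roots := by
      rw [Polynomial.mem_roots]
      · exact hx
      · intro h
        have := Br_lead ν
        simp [h] at this
    rw [hBroots] at this
    simpa using this
  have memQ : ∀ x : ℝ, (Qr ν).eval x = 0 → ∃ i < ν, s i = x := by
    intro x hx
    have : x ∈ (Qr ν).roots := by
      rw [Polynomial.mem_roots]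
      · exact hx
      · intro h
        have := Qr_lead ν hν
        simp [h] at this
    rw [hrootsR] at this
    simpa using this
  refine ⟨Qnu_natDegree ν hν, ?_, ?_, ?_, ?_, ?_, ?_⟩
  · rw [hroots]; simp
  · rw [hroots]
    exact Multiset.Nodup.map_on (fun x hx y hy h => hinj hx hy (by exact_mod_cast h))
      (Finset.range ν).nodup
  · rw [hroots]
    intro z hz
    simp only [Multiset.mem_map] at hz
    obtain ⟨i, _, rfl⟩ := hz
    simp
  · rw [hroots, Multiset.filter_map, Multiset.card_map]
    have : (Finset.range ν).filter (fun i => 0 < s i) = {0} := by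
      ext i
      simp only [Finset.mem_filter, Finset.mem_range, Finset.mem_singleton]
      constructor
      · rintro ⟨h1, h2⟩
        by_contra h3
        exact absurd (hsneg i h3 h1) (by linarith)
      · rintro rfl
        exact ⟨hν, hp⟩
    have h2 := congrArg Finset.card this
    simpa [Finset.card, Function.comp_def] using h2
  · rw [hroots, Multiset.filter_map, Multiset.card_map]
    have : (Finset.range ν).filter (fun i => s i < 0) = (Finset.range ν).erase 0 := by
      ext i
      simp only [Finset.mem_filter, Finset.mem_range, Finset.mem_erase]
      constructor
      · rintro ⟨h1, h2⟩
        refine ⟨?_, h1⟩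
        rintro rfl
        linarith
      · rintro ⟨h1, h2⟩
        exact ⟨h2, hsneg i h1 h2⟩
    have h2 := congrArg Finset.card this
    rw [Finset.card_erase_of_mem (Finset.mem_range.2 hν), Finset.card_range] at h2
    rw [← h2]
    simp [Finset.card, Function.comp_def]
  · intro a b hab ha hb hno
    simp only [aB, aQ] at *
    obtain ⟨j, hj, rfl⟩ := memB a ha
    obtain ⟨i, hi, rfl⟩ := memB b hb
    have hij : i < j := by
      by_contra h
      rcases (not_lt.1 h).eq_or_lt with h | h
      · subst h; exact lt_irrefl _ hab
      · exact absurd (hr j i h hi) (by linarith)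
    have hji : j = i + 1 := by
      by_contra h
      exact hno (r (i+1)) ⟨hr _ _ (by omega) hj, hr _ _ (by omega) (by omega)⟩ (hB _ (by omega))
    subst hji
    refine ⟨s (i+1), ⟨hs i hj, hQ _ hj⟩, ?_⟩
    rintro c ⟨⟨hc1, hc2⟩, hc⟩
    obtain ⟨k, hk, rfl⟩ := memQ c hc
    rcases k with _ | k
    · have := hn i hi; linarith
    · have h1 := hs k hk
      rcases lt_trichotomy k i with h | h | h
      · exfalso
        have : r i ≤ r (k+1) := by
          rcases (Nat.succ_le_of_lt h).eq_or_lt with h | h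
          · rw [← h]
          · exact (hr _ _ h hi).le
        linarith
      · rw [h]
      · exfalso
        have : r k ≤ r (i+1) := by
          rcases (Nat.succ_le_of_lt h).eq_or_lt with h | h
          · rw [← h]
          · exact (hr _ _ h (by omega)).le
        linarith
end

section
/- For every integer ν ≥ 1, the polynomial 4 − ζ² divides 4ν·S_{2ν}(ζ) − (2ν+1)·ζ·R_{2ν}′(ζ) in ℚ[ζ], and the quotient is an even polynomial of degree 2ν − 2 (that is, a polynomial of degree ν − 1 in ζ²) with rational coefficients. -/
/-- `R_n′(ζ) = Σ_{u=0}^{⌊(n−1)/2⌋} (n!/((n−2u−1)!·u!·(u+1)!))·ζ^{n−2u−1}` in `ℚ[ζ]`. -/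
noncomputable def Rd (n : ℕ) : Polynomial ℚ :=
  ∑ u ∈ Finset.range ((n + 1) / 2),
    Polynomial.C ((n.factorial : ℚ) /
      ((Nat.factorial (n - 2 * u - 1) * Nat.factorial u * Nat.factorial (u + 1) : ℕ) : ℚ)) *
      Polynomial.X ^ (n - 2 * u - 1)

open Polynomial in
lemma step_a (ν k : ℕ) (hk : k < ν) :
    C (4 * (ν : ℚ)) * (C (((2 * ν).factorial : ℚ) /
      ((Nat.factorial (2 * ν - 2 * k) * Nat.factorial k * Nat.factorial k : ℕ) : ℚ)) *
      X ^ (2 * ν - 2 * k)) -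
    C (2 * (ν : ℚ) + 1) * X * (C (((2 * ν).factorial : ℚ) /
      ((Nat.factorial (2 * ν - 2 * k - 1) * Nat.factorial k * Nat.factorial (k + 1) : ℕ) : ℚ)) *
      X ^ (2 * ν - 2 * k - 1)) + X ^ 2 * (C (((2 * ν).factorial : ℚ) /
      ((Nat.factorial (2 * ν - 2 * k - 2) * Nat.factorial k * Nat.factorial (k + 1) : ℕ) : ℚ)) *
      X ^ (2 * ν - 2 * k - 2)) =
    C (4 * (k : ℚ) * (((2 * ν).factorial : ℚ) /
      ((Nat.factorial (2 * ν - 2 * k) * Nat.factorial k * Nat.factorial k : ℕ) : ℚ))) *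
      X ^ (2 * ν - 2 * k) := by
  obtain ⟨d, rfl⟩ : ∃ d, ν = k + 1 + d := ⟨ν - k - 1, by omega⟩
  have e0 : 2 * (k + 1 + d) - 2 * k = 2 * d + 2 := by omega
  have e1 : 2 * (k + 1 + d) - 2 * k - 1 = 2 * d + 1 := by omega
  have e2 : 2 * (k + 1 + d) - 2 * k - 2 = 2 * d := by omega
  rw [e1, e2, e0]
  generalize Nat.factorial (2 * (k + 1 + d)) = N
  have key : 4 * ((k + 1 + d : ℕ) : ℚ) * ((N : ℚ) / ((Nat.factorial (2 * d + 2) * Nat.factorial k * Nat.factorial k : ℕ) : ℚ))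
     - (2 * ((k + 1 + d : ℕ) : ℚ) + 1) * ((N : ℚ) / ((Nat.factorial (2 * d + 1) * Nat.factorial k * Nat.factorial (k + 1) : ℕ) : ℚ))
     + ((N : ℚ) / ((Nat.factorial (2 * d) * Nat.factorial k * Nat.factorial (k + 1) : ℕ) : ℚ))
     = 4 * (k : ℚ) * ((N : ℚ) / ((Nat.factorial (2 * d + 2) * Nat.factorial k * Nat.factorial k : ℕ) : ℚ)) := by
    have h1 : (Nat.factorial (2 * d) : ℚ) ≠ 0 := by positivity
    have h2 : (Nat.factorial k : ℚ) ≠ 0 := by positivity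
    simp only [Nat.factorial_succ]
    push_cast
    have h3 : (k : ℚ) + 1 ≠ 0 := by positivity
    have h4 : 2 * (d : ℚ) + 1 ≠ 0 := by positivity
    have h5 : 2 * (d : ℚ) + 1 + 1 ≠ 0 := by positivity
    field_simp
    ring
  rw [← key]
  simp only [C_add, C_sub, C_mul]
  ring

open Polynomial in
lemma step_b (ν k : ℕ) :
    C (4 * ((k + 1 : ℕ) : ℚ) * (((2 * ν).factorial : ℚ) /
      ((Nat.factorial (2 * ν - 2 * (k + 1)) * Nat.factorial (k + 1) * Nat.factorial (k + 1) : ℕ) : ℚ))) *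
      X ^ (2 * ν - 2 * (k + 1)) =
    C 4 * (C (((2 * ν).factorial : ℚ) /
      ((Nat.factorial (2 * ν - 2 * k - 2) * Nat.factorial k * Nat.factorial (k + 1) : ℕ) : ℚ)) *
      X ^ (2 * ν - 2 * k - 2)) := by
  have e : 2 * ν - 2 * (k + 1) = 2 * ν - 2 * k - 2 := by omega
  rw [e, ← mul_assoc, ← C_mul]
  congr 2
  have h1 : (Nat.factorial (2 * ν - 2 * k - 2) : ℚ) ≠ 0 := by positivity
  have h2 : (Nat.factorial k : ℚ) ≠ 0 := by positivity
  have h3 : (k : ℚ) + 1 ≠ 0 := by positivity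
  simp only [Nat.factorial_succ]
  push_cast
  field_simp

/-- For every `ν ≥ 1`, the polynomial `4 − ζ²` divides
`4ν·S_{2ν}(ζ) − (2ν+1)·ζ·R_{2ν}′(ζ)` in `ℚ[ζ]`, and the quotient is an even polynomial of
degree `2ν − 2` (a polynomial of degree `ν − 1` in `ζ²`) with rational coefficients. -/
theorem stmt7 (ν : ℕ) (hν : 1 ≤ ν) :
    ∃ q : Polynomial ℚ,
      Polynomial.C (4 * (ν : ℚ)) * S (2 * ν) -
          Polynomial.C (2 * (ν : ℚ) + 1) * Polynomial.X * Rd (2 * ν) =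
        (Polynomial.C 4 - Polynomial.X ^ 2) * q ∧
      q.natDegree = 2 * ν - 2 ∧
      ∀ k : ℕ, Odd k → q.coeff k = 0 := by
  refine ⟨∑ k ∈ Finset.range ν, Polynomial.C (((2 * ν).factorial : ℚ) /
      ((Nat.factorial (2 * ν - 2 * k - 2) * Nat.factorial k * Nat.factorial (k + 1) : ℕ) : ℚ)) *
      Polynomial.X ^ (2 * ν - 2 * k - 2), ?_, ?_, ?_⟩
  · have hA := Finset.sum_congr (rfl : Finset.range ν = Finset.range ν)
      (fun k hk => step_a ν k (Finset.mem_range.mp hk))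
    have hB := Finset.sum_congr (rfl : Finset.range ν = Finset.range ν)
      (fun k _ => step_b ν k)
    have hT := (Finset.sum_range_succ (fun k : ℕ => Polynomial.C (4 * (k : ℚ) * (((2 * ν).factorial : ℚ) /
      ((Nat.factorial (2 * ν - 2 * k) * Nat.factorial k * Nat.factorial k : ℕ) : ℚ))) *
      (Polynomial.X : Polynomial ℚ) ^ (2 * ν - 2 * k)) ν).symm.trans (Finset.sum_range_succ' _ ν)
    rw [hB, ← hA] at hT
    have z : Polynomial.C (4 * ((0 : ℕ) : ℚ) * (((2 * ν).factorial : ℚ) /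
      ((Nat.factorial (2 * ν - 2 * 0) * Nat.factorial 0 * Nat.factorial 0 : ℕ) : ℚ))) *
      (Polynomial.X : Polynomial ℚ) ^ (2 * ν - 2 * 0) = 0 := by simp
    rw [z, add_zero] at hT
    rw [Finset.sum_add_distrib, Finset.sum_sub_distrib, ← Finset.mul_sum, ← Finset.mul_sum,
      ← Finset.mul_sum, ← Finset.mul_sum, Polynomial.C_mul (a := 4 * (ν : ℚ))] at hT
    have e1 : 2 * ν / 2 = ν := by omega
    have e2 : (2 * ν + 1) / 2 = ν := by omega
    rw [S, Rd, e1, e2, Finset.sum_range_succ]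
    linear_combination hT
  · obtain ⟨m, rfl⟩ : ∃ m, ν = m + 1 := ⟨ν - 1, by omega⟩
    apply le_antisymm
    · apply Polynomial.natDegree_sum_le_of_forall_le
      intro k _
      refine (Polynomial.natDegree_C_mul_X_pow_le _ _).trans (by omega)
    · apply Polynomial.le_natDegree_of_ne_zero
      rw [Polynomial.finsetSum_coeff, Finset.sum_eq_single 0]
      · rw [Polynomial.coeff_C_mul_X_pow, if_pos (by omega)]
        positivity
      · intro b hb h0
        have := Finset.mem_range.mp hb
        rw [Polynomial.coeff_C_mul_X_pow, if_neg (by omega)]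
      · simp
  · rintro k ⟨j, rfl⟩
    rw [Polynomial.finsetSum_coeff]
    apply Finset.sum_eq_zero
    intro i _
    rw [Polynomial.coeff_C_mul_X_pow, if_neg (by omega)]
end

section
/- For every natural number n, S_n(2) = C(2n, n) and R_n′(2) = C(2n, n+1); equivalently, Σ_{k=0}^{⌊n/2⌋} (n!/((n−2k)!·k!·k!))·2^{n−2k} = C(2n, n) and Σ_{u=0}^{⌊(n−1)/2⌋} (n!/((n−2u−1)!·u!·(u+1)!))·2^{n−2u−1} = C(2n, n+1). -/
theorem sum_split (f : ℕ → ℚ) (n : ℕ) : ∑ m ∈ Finset.range (n + 1), f m =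
    ∑ k ∈ Finset.range (n / 2 + 1), f (2 * k) + ∑ u ∈ Finset.range ((n + 1) / 2), f (2 * u + 1) := by
  induction n with
  | zero => simp
  | succ n ih =>
    rw [Finset.sum_range_succ, ih]
    obtain ⟨r, hr | hr⟩ := n.even_or_odd'
    · have h1 : (n + 1) / 2 = r := by omega
      have h2 : (n + 1 + 1) / 2 = r + 1 := by omega
      have h3 : n / 2 = r := by omega
      rw [h1, h2, h3, Finset.sum_range_succ (fun u => f (2 * u + 1)), hr]
      ring
    · have h1 : (n + 1) / 2 = r + 1 := by omega
      have h2 : (n + 1 + 1) / 2 = r + 1 := by omega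
      have h3 : n / 2 = r := by omega
      rw [h1, h2, h3, Finset.sum_range_succ (fun u => f (2 * u)) (r + 1), hr]
      have : 2 * r + 1 + 1 = 2 * (r + 1) := by ring
      rw [this]
      ring

theorem coeff_main (n j : ℕ) : ((2 * n).choose (n + j) : ℚ) =
    ∑ m ∈ Finset.range (n + 1), (if 2 ∣ m + j then (m.choose ((m + j) / 2) : ℚ) else 0)
      * 2 ^ (n - m) * (n.choose m : ℚ) := by
  have h : ((1 + Polynomial.X : Polynomial ℚ)) ^ (2 * n)
      = (Polynomial.expand ℚ 2 (1 + Polynomial.X) + Polynomial.C 2 * Polynomial.X) ^ n := by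
    rw [pow_mul]
    congr 1
    simp only [map_add, map_one, Polynomial.expand_X, map_ofNat]
    ring
  have h2 := congrArg (fun p => Polynomial.coeff p (n + j)) h
  simp only [Polynomial.coeff_one_add_X_pow] at h2
  rw [h2, add_pow, Polynomial.finset_sum_coeff]
  refine Finset.sum_congr rfl fun m hm => ?_
  have hm' : m ≤ n := by simpa [Nat.lt_succ_iff] using hm
  have e : n + j = (m + j) + (n - m) := by omega
  rw [← map_pow, mul_pow, ← Polynomial.C_pow, ← Polynomial.C_eq_natCast, Polynomial.coeff_mul_C,
    mul_left_comm, Polynomial.coeff_C_mul, e, Polynomial.coeff_mul_X_pow,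
    Polynomial.coeff_expand (by norm_num), Polynomial.coeff_one_add_X_pow]
  ring

theorem choose_fact (n m a b : ℕ) (h : m ≤ n) (hab : a + b = m) :
    (n.factorial : ℚ) / ((Nat.factorial (n - m) * Nat.factorial a * Nat.factorial b : ℕ) : ℚ)
     = (m.choose b : ℚ) * (n.choose m : ℚ) := by
  subst hab
  rw [Nat.cast_choose ℚ h, Nat.cast_choose ℚ (Nat.le_add_left b a), Nat.add_sub_cancel]
  have := Nat.factorial_ne_zero (a + b)
  have := Nat.factorial_ne_zero (n - (a + b))
  have := Nat.factorial_ne_zero a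
  have := Nat.factorial_ne_zero b
  push_cast
  field_simp

/-- For every natural number `n`, `S_n(2) = C(2n, n)` and `R_n′(2) = C(2n, n+1)`. -/
theorem stmt8 (n : ℕ) :
    Polynomial.eval (2 : ℚ) (S n) = ((2 * n).choose n : ℚ) ∧
    Polynomial.eval (2 : ℚ) (Rd n) = ((2 * n).choose (n + 1) : ℚ) := by
  constructor
  · have h := coeff_main n 0
    rw [sum_split] at h
    rw [add_zero] at h
    rw [h, S, Polynomial.eval_finset_sum, Finset.sum_eq_zero (s := Finset.range ((n + 1) / 2)), add_zero]
    · refine Finset.sum_congr rfl fun k hk => ?_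
      have hk' : 2 * k ≤ n := by have := Finset.mem_range.1 hk; omega
      rw [choose_fact n (2 * k) k k hk' (by ring), if_pos (by omega)]
      have e : (2 * k + 0) / 2 = k := by omega
      rw [e]
      simp only [Polynomial.eval_mul, Polynomial.eval_C, Polynomial.eval_pow, Polynomial.eval_X]
      ring
    · intro u _
      rw [if_neg (by omega)]
      ring
  · have h := coeff_main n 1
    rw [sum_split] at h
    rw [h, Rd, Polynomial.eval_finset_sum, Finset.sum_eq_zero (s := Finset.range (n / 2 + 1)), zero_add]
    · refine Finset.sum_congr rfl fun k hk => ?_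
      have hk' : 2 * k + 1 ≤ n := by have := Finset.mem_range.1 hk; omega
      rw [Nat.sub_sub, choose_fact n (2 * k + 1) k (k + 1) hk' (by ring), if_pos (by omega)]
      have e : (2 * k + 1 + 1) / 2 = k + 1 := by omega
      rw [e]
      simp only [Polynomial.eval_mul, Polynomial.eval_C, Polynomial.eval_pow, Polynomial.eval_X]
      ring
    · intro u _
      rw [if_neg (by omega)]
      ring
end

section
/- (Unwinding identity) Let j ≥ 1 be an integer, I ⊆ ℝ an open interval, and h, f : I → ℝ differentiable functions with f nowhere zero. For −1 ≤ m ≤ j − 1 define the string functions φ_m(x) = (j!/(j−m−1)!)·P_{j−m−1}(h(x), f(x)) and ψ_m(x) = (j!/(j−m−1)!)·Q_{j−m−1}(h(x), f(x)). Then for every m with 0 ≤ m ≤ j − 1 and every x ∈ I: φ_{m−1}′(x) = h′(x)·φ_m(x) + (f′(x)/f(x))·ψ_m(x) and ψ_{m−1}′(x) = f′(x)·φ_m(x) + h′(x)·ψ_m(x). -/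
/-- The string polynomial `P_N(h,f) = Σ_{k=0}^{⌊N/2⌋} (N!/((N−2k)!·k!·k!))·h^{N−2k}·f^k`,
the coefficient of `η⁰` in `(√f·η + h + √f·η⁻¹)^N`. -/
noncomputable def Pstr (N : ℕ) (h f : ℝ) : ℝ :=
  ∑ k ∈ Finset.range (N / 2 + 1),
    ((N.factorial : ℝ) /
        ((Nat.factorial (N - 2 * k) * Nat.factorial k * Nat.factorial k : ℕ) : ℝ)) *
      h ^ (N - 2 * k) * f ^ k

/-- The string polynomial
`Q_N(h,f) = Σ_{u=0}^{⌊(N−1)/2⌋} (N!/((N−2u−1)!·u!·(u+1)!))·h^{N−2u−1}·f^{u+1}`,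
`√f` times the coefficient of `η⁻¹` in `(√f·η + h + √f·η⁻¹)^N`. -/
noncomputable def Qstr (N : ℕ) (h f : ℝ) : ℝ :=
  ∑ u ∈ Finset.range ((N + 1) / 2),
    ((N.factorial : ℝ) /
        ((Nat.factorial (N - 2 * u - 1) * Nat.factorial u * Nat.factorial (u + 1) : ℕ) : ℝ)) *
      h ^ (N - 2 * u - 1) * f ^ (u + 1)

/-- `h^(N-d)/(N-d)!`, and zero if `d > N`. -/
noncomputable def eTerm (N d : ℕ) (h : ℝ) : ℝ :=
  if d ≤ N then h ^ (N - d) / ((N - d).factorial : ℝ) else 0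

lemma eTerm_succ (N d : ℕ) (h : ℝ) : eTerm (N + 1) (d + 1) h = eTerm N d h := by
  simp [eTerm]

lemma eTerm_deriv (N d : ℕ) (h : ℝ → ℝ) (h' x : ℝ) (hh : HasDerivAt h h' x) :
    HasDerivAt (fun y => eTerm (N + 1) d (h y)) (h' * eTerm N d (h x)) x := by
  by_cases h1 : d ≤ N
  · have h2 : d ≤ N + 1 := by omega
    have h3 : N + 1 - d = (N - d) + 1 := by omega
    simp only [eTerm, h1, h2, if_true, h3]
    refine ((hh.fun_pow (N - d + 1)).div_const (((N - d + 1).factorial : ℕ) : ℝ)).congr_deriv ?_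
    rw [Nat.factorial_succ]
    have : ((N - d).factorial : ℝ) ≠ 0 := by positivity
    have : ((N - d : ℕ) : ℝ) + 1 ≠ 0 := by positivity
    push_cast
    try simp only [Nat.add_sub_cancel]
    field_simp
  · by_cases h2 : d = N + 1
    · subst h2
      simpa [eTerm] using hasDerivAt_const x (1 : ℝ)
    · have h3 : ¬ d ≤ N + 1 := by omega
      simpa [eTerm, h1, h3] using hasDerivAt_const x (0 : ℝ)

lemma Pstr_eq (N K : ℕ) (hK : N / 2 + 1 ≤ K) (h f : ℝ) :
    Pstr N h f = (N.factorial : ℝ) * ∑ k ∈ Finset.range K,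
      eTerm N (2 * k) h * (f ^ k / ((k.factorial : ℝ) * (k.factorial : ℝ))) := by
  rw [← Finset.sum_subset (Finset.range_subset_range.2 hK)]
  · rw [Pstr, Finset.mul_sum]
    refine Finset.sum_congr rfl fun k hk => ?_
    have : 2 * k ≤ N := by have := Finset.mem_range.1 hk; omega
    simp only [eTerm, this, if_true]
    push_cast
    field_simp
  · intro k _ hk
    have : ¬ 2 * k ≤ N := by rw [Finset.mem_range] at hk; omega
    simp [eTerm, this]

lemma Qstr_eq (N K : ℕ) (hK : (N + 1) / 2 ≤ K) (h f : ℝ) :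
    Qstr N h f = (N.factorial : ℝ) * ∑ k ∈ Finset.range K,
      eTerm N (2 * k + 1) h * (f ^ (k + 1) / ((k.factorial : ℝ) * ((k + 1).factorial : ℝ))) := by
  rw [← Finset.sum_subset (Finset.range_subset_range.2 hK)]
  · rw [Qstr, Finset.mul_sum]
    refine Finset.sum_congr rfl fun k hk => ?_
    have : 2 * k + 1 ≤ N := by have := Finset.mem_range.1 hk; omega
    simp only [eTerm, this, if_true, Nat.sub_sub]
    push_cast
    field_simp
  · intro k _ hk
    have : ¬ 2 * k + 1 ≤ N := by rw [Finset.mem_range] at hk; omega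
    simp [eTerm, this]

lemma P_deriv (N : ℕ) (h f : ℝ → ℝ) (h' f' x : ℝ) (hh : HasDerivAt h h' x)
    (hf : HasDerivAt f f' x) (hf0 : f x ≠ 0) :
    HasDerivAt (fun y => ∑ k ∈ Finset.range (N + 2),
        eTerm (N + 1) (2 * k) (h y) * (f y ^ k / ((k.factorial : ℝ) * (k.factorial : ℝ))))
      (h' * (∑ k ∈ Finset.range (N + 2),
        eTerm N (2 * k) (h x) * (f x ^ k / ((k.factorial : ℝ) * (k.factorial : ℝ)))) +
       f' / f x * ∑ k ∈ Finset.range (N + 1), eTerm N (2 * k + 1) (h x) *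
          (f x ^ (k + 1) / ((k.factorial : ℝ) * ((k + 1).factorial : ℝ)))) x := by
  have key := HasDerivAt.fun_sum (u := Finset.range (N + 2)) (fun k _ =>
    (eTerm_deriv N (2 * k) h h' x hh).fun_mul
      ((hf.fun_pow k).div_const ((k.factorial : ℝ) * (k.factorial : ℝ))))
  refine key.congr_deriv ?_
  rw [Finset.sum_add_distrib, Finset.mul_sum, Finset.mul_sum]
  congr 1
  · exact Finset.sum_congr rfl fun k _ => by ring
  · rw [Finset.sum_range_succ']
    simp only [Nat.cast_zero, zero_mul, zero_div, mul_zero, add_zero]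
    refine Finset.sum_congr rfl fun k _ => ?_
    rw [show 2 * (k + 1) = 2 * k + 1 + 1 by ring, eTerm_succ, Nat.factorial_succ]
    have : (k.factorial : ℝ) ≠ 0 := by positivity
    have : (k : ℝ) + 1 ≠ 0 := by positivity
    push_cast
    try simp only [Nat.add_sub_cancel]
    field_simp
    ring

lemma Q_deriv (N : ℕ) (h f : ℝ → ℝ) (h' f' x : ℝ) (hh : HasDerivAt h h' x)
    (hf : HasDerivAt f f' x) :
    HasDerivAt (fun y => ∑ k ∈ Finset.range (N + 2), eTerm (N + 1) (2 * k + 1) (h y) *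
          (f y ^ (k + 1) / ((k.factorial : ℝ) * ((k + 1).factorial : ℝ))))
      (f' * (∑ k ∈ Finset.range (N + 2),
        eTerm N (2 * k) (h x) * (f x ^ k / ((k.factorial : ℝ) * (k.factorial : ℝ)))) +
       h' * ∑ k ∈ Finset.range (N + 2), eTerm N (2 * k + 1) (h x) *
          (f x ^ (k + 1) / ((k.factorial : ℝ) * ((k + 1).factorial : ℝ)))) x := by
  have key := HasDerivAt.fun_sum (u := Finset.range (N + 2)) (fun k _ =>
    (eTerm_deriv N (2 * k + 1) h h' x hh).fun_mul
      ((hf.fun_pow (k + 1)).div_const ((k.factorial : ℝ) * ((k + 1).factorial : ℝ))))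
  refine key.congr_deriv ?_
  rw [Finset.mul_sum, Finset.mul_sum, ← Finset.sum_add_distrib]
  refine Finset.sum_congr rfl fun k _ => ?_
  rw [eTerm_succ, Nat.factorial_succ]
  have : (k.factorial : ℝ) ≠ 0 := by positivity
  have : (k : ℝ) + 1 ≠ 0 := by positivity
  push_cast
  try simp only [Nat.add_sub_cancel]
  field_simp
  ring

/-- **Unwinding identity.** Let `j ≥ 1`, `I ⊆ ℝ` an open interval, and `h, f : I → ℝ`
differentiable with `f` nowhere zero.  With the string functions
`φ_m(x) = (j!/(j−m−1)!)·P_{j−m−1}(h x, f x)` and `ψ_m(x) = (j!/(j−m−1)!)·Q_{j−m−1}(h x, f x)`,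
for every `0 ≤ m ≤ j − 1` and `x ∈ I` one has
`φ_{m−1}′(x) = h′(x)·φ_m(x) + (f′(x)/f(x))·ψ_m(x)` and
`ψ_{m−1}′(x) = f′(x)·φ_m(x) + h′(x)·ψ_m(x)`
(here `φ_{m−1}(x) = (j!/(j−m)!)·P_{j−m}(h x, f x)` and similarly for `ψ_{m−1}`). -/
theorem stmt9 (j : ℕ) (hj : 1 ≤ j) (I : Set ℝ) (hI : IsOpen I) (hI' : I.OrdConnected)
    (h f h' f' : ℝ → ℝ)
    (hh : ∀ x ∈ I, HasDerivAt h (h' x) x)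
    (hf : ∀ x ∈ I, HasDerivAt f (f' x) x)
    (hf0 : ∀ x ∈ I, f x ≠ 0)
    (φ ψ : ℕ → ℝ → ℝ)
    (hφ : ∀ m x, φ m x = ((j.factorial : ℝ) / ((j - m - 1).factorial : ℝ)) *
      Pstr (j - m - 1) (h x) (f x))
    (hψ : ∀ m x, ψ m x = ((j.factorial : ℝ) / ((j - m - 1).factorial : ℝ)) *
      Qstr (j - m - 1) (h x) (f x)) :
    ∀ m : ℕ, m ≤ j - 1 → ∀ x ∈ I,
      HasDerivAt
        (fun y => ((j.factorial : ℝ) / ((j - m).factorial : ℝ)) * Pstr (j - m) (h y) (f y))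
        (h' x * φ m x + (f' x / f x) * ψ m x) x ∧
      HasDerivAt
        (fun y => ((j.factorial : ℝ) / ((j - m).factorial : ℝ)) * Qstr (j - m) (h y) (f y))
        (f' x * φ m x + h' x * ψ m x) x := by
  intro m hm x hx
  obtain ⟨N, hN⟩ : ∃ N, j - m = N + 1 := ⟨j - m - 1, by omega⟩
  have c : ∀ n : ℕ, (n.factorial : ℝ) ≠ 0 := fun n => by positivity
  have cc : ∀ (n : ℕ) (S : ℝ), (j.factorial : ℝ) / (n.factorial : ℝ) * ((n.factorial : ℝ) * S)
      = (j.factorial : ℝ) * S := fun n S => by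
    have := c n
    field_simp
  rw [hφ, hψ, hN, Nat.add_sub_cancel]
  constructor
  · simp only [Pstr_eq (N + 1) (N + 2) (by omega), Pstr_eq N (N + 2) (by omega),
      Qstr_eq N (N + 1) (by omega), cc]
    refine ((P_deriv N h f _ _ x (hh x hx) (hf x hx) (hf0 x hx)).const_mul
      (j.factorial : ℝ)).congr_deriv ?_
    ring
  · simp only [Qstr_eq (N + 1) (N + 2) (by omega), Pstr_eq N (N + 2) (by omega),
      Qstr_eq N (N + 2) (by omega), cc]
    refine ((Q_deriv N h f _ _ x (hh x hx) (hf x hx)).const_mul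
      (j.factorial : ℝ)).congr_deriv ?_
    ring
end

section
/- Fix an integer ν ≥ 1 and define in ℚ[h,f] the fluxes F₁(h,f) = Σ_{μ=0}^{ν} ((2ν+1)!/((2μ)!·(ν−μ)!·(ν−μ+1)!))·h^{2μ}·f^{ν−μ+1} and F₂(h,f) = Σ_{μ=0}^{ν−1} ((2ν+1)!/((2μ+1)!·(ν−μ−1)!·(ν−μ+1)!))·h^{2μ+1}·f^{ν−μ+1}, and the coefficients B₁₁(h,f) = Σ_{μ=1}^{ν} ((2ν)!/((2μ−1)!·(ν−μ)!·(ν−μ+1)!))·h^{2μ−1}·f^{ν−μ+1} and B₁₂(h,f) = Σ_{μ=0}^{ν} ((2ν)!/((2μ)!·((ν−μ)!)²))·h^{2μ}·f^{ν−μ}. Then the following polynomial identities hold: ∂_h F₁ = (2ν+1)·B₁₁; ∂_f F₁ = (2ν+1)·B₁₂; F₁ + ∂_h F₂ = (2ν+1)·f·B₁₂; ∂_f F₂ = (2ν+1)·B₁₁; ∂_f B₁₁ = ∂_h B₁₂; and ∂_h B₁₁ = f·∂_f B₁₂. -/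
open MvPolynomial

/-- The flux `F₁(h,f) = Σ_{μ=0}^{ν} ((2ν+1)!/((2μ)!·(ν−μ)!·(ν−μ+1)!))·h^{2μ}·f^{ν−μ+1}`
in `ℚ[h,f]`, with `h = X 0` and `f = X 1`. -/
noncomputable def F1 (ν : ℕ) : MvPolynomial (Fin 2) ℚ :=
  ∑ μ ∈ Finset.range (ν + 1),
    C (((2 * ν + 1).factorial : ℚ) /
        ((Nat.factorial (2 * μ) * (Nat.factorial (ν - μ) * Nat.factorial (ν - μ + 1)) : ℕ) : ℚ)) *
      X 0 ^ (2 * μ) * X 1 ^ (ν - μ + 1)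

/-- The flux `F₂(h,f) = Σ_{μ=0}^{ν−1} ((2ν+1)!/((2μ+1)!·(ν−μ−1)!·(ν−μ+1)!))·h^{2μ+1}·f^{ν−μ+1}`. -/
noncomputable def F2 (ν : ℕ) : MvPolynomial (Fin 2) ℚ :=
  ∑ μ ∈ Finset.range ν,
    C (((2 * ν + 1).factorial : ℚ) /
        ((Nat.factorial (2 * μ + 1) * (Nat.factorial (ν - μ - 1) * Nat.factorial (ν - μ + 1)) : ℕ) : ℚ)) *
      X 0 ^ (2 * μ + 1) * X 1 ^ (ν - μ + 1)

/-- `B₁₁(h,f) = Σ_{μ=1}^{ν} ((2ν)!/((2μ−1)!·(ν−μ)!·(ν−μ+1)!))·h^{2μ−1}·f^{ν−μ+1}`. -/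
noncomputable def B11 (ν : ℕ) : MvPolynomial (Fin 2) ℚ :=
  ∑ μ ∈ Finset.Icc 1 ν,
    C (((2 * ν).factorial : ℚ) /
        ((Nat.factorial (2 * μ - 1) * (Nat.factorial (ν - μ) * Nat.factorial (ν - μ + 1)) : ℕ) : ℚ)) *
      X 0 ^ (2 * μ - 1) * X 1 ^ (ν - μ + 1)

/-- `B₁₂(h,f) = Σ_{μ=0}^{ν} ((2ν)!/((2μ)!·((ν−μ)!)²))·h^{2μ}·f^{ν−μ}`. -/
noncomputable def B12 (ν : ℕ) : MvPolynomial (Fin 2) ℚ :=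
  ∑ μ ∈ Finset.range (ν + 1),
    C (((2 * ν).factorial : ℚ) /
        ((Nat.factorial (2 * μ) * (Nat.factorial (ν - μ) * Nat.factorial (ν - μ)) : ℕ) : ℚ)) *
      X 0 ^ (2 * μ) * X 1 ^ (ν - μ)

theorem pd0 (c : ℚ) (a b : ℕ) :
    pderiv (0 : Fin 2) (C c * X 0 ^ a * X 1 ^ b : MvPolynomial (Fin 2) ℚ) =
      C (c * a) * X 0 ^ (a - 1) * X 1 ^ b := by
  simp [Derivation.leibniz, Derivation.leibniz_pow, pderiv_X]
  ring

theorem pd1 (c : ℚ) (a b : ℕ) :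
    pderiv (1 : Fin 2) (C c * X 0 ^ a * X 1 ^ b : MvPolynomial (Fin 2) ℚ) =
      C (c * b) * X 0 ^ a * X 1 ^ (b - 1) := by
  simp [Derivation.leibniz, Derivation.leibniz_pow, pderiv_X]
  ring

theorem B11_eq (ν : ℕ) : B11 ν = ∑ μ ∈ Finset.range ν,
    C (((2 * ν).factorial : ℚ) /
        ((Nat.factorial (2 * μ + 1) * (Nat.factorial (ν - μ - 1) * Nat.factorial (ν - μ)) : ℕ) : ℚ)) *
      X 0 ^ (2 * μ + 1) * X 1 ^ (ν - μ) := by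
  unfold B11
  rw [Finset.range_eq_Ico, ← Finset.Ico_add_one_right_eq_Icc,
    ← Finset.sum_Ico_add' _ 0 ν 1]
  refine Finset.sum_congr rfl fun μ hμ => ?_
  have h : μ < ν := (Finset.mem_Ico.mp hμ).2
  rw [show 2 * (μ + 1) - 1 = 2 * μ + 1 by omega, show ν - (μ + 1) = ν - μ - 1 by omega,
    show ν - μ - 1 + 1 = ν - μ by omega]

theorem Cmul3 (d c : ℚ) (p q : MvPolynomial (Fin 2) ℚ) :
    C d * (C c * p * q) = C (d * c) * p * q := by
  rw [C_mul]; ring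

theorem CXmul3 (d c : ℚ) (p : MvPolynomial (Fin 2) ℚ) (b : ℕ) :
    C d * X 1 * (C c * p * X 1 ^ b) = C (d * c) * p * X 1 ^ (b + 1) := by
  rw [C_mul]; ring

theorem Xmul3 (c : ℚ) (p : MvPolynomial (Fin 2) ℚ) (b : ℕ) :
    X 1 * (C c * p * X 1 ^ b) = C c * p * X 1 ^ (b + 1) := by
  ring

/-- The flux-gradient identities: `∂_h F₁ = (2ν+1)·B₁₁`, `∂_f F₁ = (2ν+1)·B₁₂`,
`F₁ + ∂_h F₂ = (2ν+1)·f·B₁₂`, `∂_f F₂ = (2ν+1)·B₁₁`, `∂_f B₁₁ = ∂_h B₁₂`, and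
`∂_h B₁₁ = f·∂_f B₁₂`. -/
theorem stmt11 (ν : ℕ) (hν : 1 ≤ ν) :
    pderiv 0 (F1 ν) = C (2 * (ν : ℚ) + 1) * B11 ν ∧
    pderiv 1 (F1 ν) = C (2 * (ν : ℚ) + 1) * B12 ν ∧
    F1 ν + pderiv 0 (F2 ν) = C (2 * (ν : ℚ) + 1) * X 1 * B12 ν ∧
    pderiv 1 (F2 ν) = C (2 * (ν : ℚ) + 1) * B11 ν ∧
    pderiv 1 (B11 ν) = pderiv 0 (B12 ν) ∧
    pderiv 0 (B11 ν) = X 1 * pderiv 1 (B12 ν) := by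
  refine ⟨?_, ?_, ?_, ?_, ?_, ?_⟩
  · rw [B11_eq, F1, Finset.sum_range_succ', map_add, map_sum, Finset.mul_sum]
    simp only [pd0, Cmul3]
    simp only [mul_zero, Nat.cast_zero, C_0, zero_mul, add_zero]
    refine Finset.sum_congr rfl fun μ hμ => ?_
    obtain ⟨k, rfl⟩ := Nat.exists_eq_add_of_lt (Finset.mem_range.mp hμ)
    rw [show μ + k + 1 - (μ + 1) = k by omega, show μ + k + 1 - μ = k + 1 by omega,
      show 2 * (μ + 1) - 1 = 2 * μ + 1 by omega, show 2 * (μ + 1) = 2 * μ + 1 + 1 by omega,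
      Nat.add_sub_cancel]
    congr 3
    simp only [Nat.factorial_succ]
    push_cast
    field_simp
    try ring
  · rw [B12, F1, map_sum, Finset.mul_sum]
    simp only [pd1, Cmul3]
    refine Finset.sum_congr rfl fun μ hμ => ?_
    rw [Nat.add_sub_cancel]
    congr 3
    simp only [Nat.factorial_succ]
    push_cast
    field_simp
    try ring
  · rw [B12, F1, F2, map_sum, Finset.mul_sum, Finset.sum_range_succ, Finset.sum_range_succ]
    simp only [pd0, CXmul3]
    rw [add_right_comm, ← Finset.sum_add_distrib]
    congr 1
    · refine Finset.sum_congr rfl fun μ hμ => ?_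
      obtain ⟨k, rfl⟩ := Nat.exists_eq_add_of_lt (Finset.mem_range.mp hμ)
      rw [show μ + k + 1 - μ = k + 1 by omega, Nat.add_sub_cancel, Nat.add_sub_cancel,
        ← add_mul, ← add_mul, ← C_add]
      congr 3
      simp only [Nat.factorial_succ]
      push_cast
      field_simp
      try ring
    · congr 3
      simp only [Nat.factorial_succ, Nat.sub_self]
      push_cast
      field_simp
      try simp
  · rw [B11_eq, F2, map_sum, Finset.mul_sum]
    simp only [pd1, Cmul3]
    refine Finset.sum_congr rfl fun μ hμ => ?_
    rw [Nat.add_sub_cancel]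
    congr 3
    simp only [Nat.factorial_succ]
    push_cast
    field_simp
    try ring
  · rw [B11_eq, B12, Finset.sum_range_succ', map_add, map_sum, map_sum]
    simp only [pd0, pd1]
    simp only [mul_zero, Nat.cast_zero, C_0, zero_mul, add_zero]
    refine Finset.sum_congr rfl fun μ hμ => ?_
    obtain ⟨k, rfl⟩ := Nat.exists_eq_add_of_lt (Finset.mem_range.mp hμ)
    rw [show μ + k + 1 - (μ + 1) = k by omega, show μ + k + 1 - μ = k + 1 by omega,
      show 2 * (μ + 1) - 1 = 2 * μ + 1 by omega,
      show (2 * (μ + 1)) = 2 * μ + 1 + 1 by omega, Nat.add_sub_cancel]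
    congr 3
    simp only [Nat.factorial_succ]
    push_cast
    field_simp
    try ring
  · rw [B11_eq, B12, Finset.sum_range_succ, map_add, map_sum, map_sum, mul_add, Finset.mul_sum]
    simp only [pd0, pd1, Xmul3]
    simp only [Nat.sub_self, mul_zero, Nat.cast_zero, C_0, zero_mul, add_zero]
    refine Finset.sum_congr rfl fun μ hμ => ?_
    obtain ⟨k, rfl⟩ := Nat.exists_eq_add_of_lt (Finset.mem_range.mp hμ)
    rw [show μ + k + 1 - μ = k + 1 by omega, Nat.add_sub_cancel, Nat.add_sub_cancel]
    congr 3
    simp only [Nat.factorial_succ]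
    push_cast
    field_simp
    try ring
end

section
/- Fix an integer ν ≥ 1 (valence j = 2ν+1). Let t, w, h be real numbers and f > 0 a real number satisfying the leading-order string (hodograph) equations h + (2ν+1)·t·P_{2ν}(h, f) = 0 and f + (2ν+1)·t·Q_{2ν}(h, f) = w. Set ζ = h/√f. Then S_{2ν}(ζ) ≠ 0, one has f·(S_{2ν}(ζ) − ζ·R_{2ν}′(ζ)) = w·S_{2ν}(ζ), and the spectral-curve equation holds: t²·w^{2ν−1}·(2ν+1)²·S_{2ν}(ζ)^{2ν+1} = ζ²·(S_{2ν}(ζ) − ζ·R_{2ν}′(ζ))^{2ν−1}. -/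
lemma aeval_S_real (n : ℕ) (ζ : ℝ) : Polynomial.aeval ζ (S n) =
    ∑ k ∈ Finset.range (n / 2 + 1), ((n.factorial : ℝ) /
        ((Nat.factorial (n - 2 * k) * Nat.factorial k * Nat.factorial k : ℕ) : ℝ)) *
      ζ ^ (n - 2 * k) := by
  unfold S
  simp [Polynomial.aeval_C]

lemma aeval_Rd_real (n : ℕ) (ζ : ℝ) : Polynomial.aeval ζ (Rd n) =
    ∑ u ∈ Finset.range ((n + 1) / 2), ((n.factorial : ℝ) /
        ((Nat.factorial (n - 2 * u - 1) * Nat.factorial u * Nat.factorial (u + 1) : ℕ) : ℝ)) *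
      ζ ^ (n - 2 * u - 1) := by
  unfold Rd
  simp [Polynomial.aeval_C]

lemma Pstr_scale (n : ℕ) (ζ s : ℝ) :
    Pstr n (ζ * s) (s ^ 2) = s ^ n * Polynomial.aeval ζ (S n) := by
  rw [aeval_S_real, Pstr, Finset.mul_sum]
  refine Finset.sum_congr rfl fun k hk => ?_
  have hk' := Finset.mem_range.1 hk
  have e : s ^ n = s ^ (n - 2 * k) * (s ^ 2) ^ k := by
    rw [← pow_mul, ← pow_add]; congr 1; omega
  rw [e, mul_pow]; ring

lemma Qstr_scale (n : ℕ) (ζ s : ℝ) :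
    Qstr n (ζ * s) (s ^ 2) = s ^ (n + 1) * Polynomial.aeval ζ (Rd n) := by
  rw [aeval_Rd_real, Qstr, Finset.mul_sum]
  refine Finset.sum_congr rfl fun k hk => ?_
  have hk' := Finset.mem_range.1 hk
  have e : s ^ (n + 1) = s ^ (n - 2 * k - 1) * (s ^ 2) ^ (k + 1) := by
    rw [← pow_mul, ← pow_add]; congr 1; omega
  rw [e, mul_pow]; ring

lemma aeval_S_pos (ν : ℕ) (ζ : ℝ) : 0 < Polynomial.aeval ζ (S (2 * ν)) := by
  rw [aeval_S_real]
  refine Finset.sum_pos' (fun k _ => ?_) ⟨ν, by simp, ?_⟩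
  · have : 2 * ν - 2 * k = 2 * (ν - k) := by omega
    rw [this, pow_mul]
    positivity
  · rw [Nat.sub_self, pow_zero]
    positivity

/-- Fix `ν ≥ 1` (valence `j = 2ν+1`).  If real `t, w, h` and `f > 0` satisfy the
leading-order string (hodograph) equations
`h + (2ν+1)·t·P_{2ν}(h,f) = 0` and `f + (2ν+1)·t·Q_{2ν}(h,f) = w`,
then with `ζ = h/√f`: `S_{2ν}(ζ) ≠ 0`, one has
`f·(S_{2ν}(ζ) − ζ·R_{2ν}′(ζ)) = w·S_{2ν}(ζ)`, and the spectral-curve equation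
`t²·w^{2ν−1}·(2ν+1)²·S_{2ν}(ζ)^{2ν+1} = ζ²·(S_{2ν}(ζ) − ζ·R_{2ν}′(ζ))^{2ν−1}` holds. -/
theorem stmt12 (ν : ℕ) (hν : 1 ≤ ν) (t w h f : ℝ) (hf : 0 < f)
    (hstr1 : h + (2 * (ν : ℝ) + 1) * t * Pstr (2 * ν) h f = 0)
    (hstr2 : f + (2 * (ν : ℝ) + 1) * t * Qstr (2 * ν) h f = w) :
    ∀ ζ : ℝ, ζ = h / Real.sqrt f →
      Polynomial.aeval ζ (S (2 * ν)) ≠ 0 ∧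
      f * (Polynomial.aeval ζ (S (2 * ν)) - ζ * Polynomial.aeval ζ (Rd (2 * ν))) =
        w * Polynomial.aeval ζ (S (2 * ν)) ∧
      t ^ 2 * w ^ (2 * ν - 1) * (2 * (ν : ℝ) + 1) ^ 2 *
          (Polynomial.aeval ζ (S (2 * ν))) ^ (2 * ν + 1) =
        ζ ^ 2 * (Polynomial.aeval ζ (S (2 * ν)) -
          ζ * Polynomial.aeval ζ (Rd (2 * ν))) ^ (2 * ν - 1) := by
  intro ζ hζ
  have hs : 0 < Real.sqrt f := Real.sqrt_pos.2 hf
  have hsq : f = Real.sqrt f ^ 2 := (Real.sq_sqrt hf.le).symm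
  have hh : h = ζ * Real.sqrt f := by rw [hζ]; field_simp
  generalize Real.sqrt f = s at hs hsq hh
  clear hζ
  subst hsq hh
  rw [Pstr_scale] at hstr1
  rw [Qstr_scale] at hstr2
  have hpos := aeval_S_pos ν ζ
  generalize Polynomial.aeval ζ (S (2 * ν)) = A at *
  generalize Polynomial.aeval ζ (Rd (2 * ν)) = B at *
  obtain ⟨m, rfl⟩ : ∃ m, ν = m + 1 := ⟨ν - 1, by omega⟩
  generalize 2 * ((m + 1 : ℕ) : ℝ) + 1 = c at *
  have e1 : 2 * (m + 1) - 1 = 2 * m + 1 := by omega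
  have e2 : 2 * (m + 1) = 2 * m + 1 + 1 := by ring
  rw [e1]
  rw [e2] at hstr1 hstr2 ⊢
  generalize 2 * m + 1 = p at *
  have h1 : ζ = -(c * t * s ^ p * A) := by
    have : s * (ζ + c * t * s ^ p * A) = 0 := by rw [← hstr1]; ring
    rcases mul_eq_zero.1 this with h0 | h0
    · exact absurd h0 hs.ne'
    · linarith
  have h2 : s ^ 2 * (A - ζ * B) = w * A := by
    rw [← hstr2, h1]; ring
  refine ⟨hpos.ne', h2, ?_⟩
  calc t ^ 2 * w ^ p * c ^ 2 * A ^ (p + 1 + 1)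
      = t ^ 2 * c ^ 2 * A ^ 2 * (w * A) ^ p := by rw [mul_pow]; ring
    _ = (-(c * t * s ^ p * A)) ^ 2 * (A - ζ * B) ^ p := by
        rw [← h2, mul_pow (s ^ 2), ← pow_mul, mul_comm 2 p, pow_mul]; ring
    _ = ζ ^ 2 * (A - ζ * B) ^ p := by rw [← h1]
end

section
/- Let j ≥ 3 be a real number, I ⊆ ℝ an open interval, and h, f : I → ℝ differentiable functions with f nowhere zero. Define D(x) = (j·x − (j−2)·f(x))² − (j−2)²·f(x)·h(x)². Assume D is nowhere zero on I and that for all x ∈ I the prolonged string system holds: D(x)·h′(x) = h(x)·(j·x + (j−2)·f(x)) and D(x)·f′(x) = (j−2)·f(x)·h(x)² + 2·f(x)·(j·x − (j−2)·f(x)). Then the function y(x) = h(x)²/f(x) satisfies D(x)·y′(x) = (j−2)·f(x)·y(x)·(4 − y(x)) for all x ∈ I. -/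
/-- Let `j ≥ 3`, `I ⊆ ℝ` an open interval, and `h, f : I → ℝ` differentiable with `f`
nowhere zero.  Set `D(x) = (j·x − (j−2)·f(x))² − (j−2)²·f(x)·h(x)²` and assume `D` is
nowhere zero and the prolonged string system
`D·h′ = h·(j·x + (j−2)·f)` and `D·f′ = (j−2)·f·h² + 2·f·(j·x − (j−2)·f)` holds on `I`.
Then `y = h²/f` satisfies `D·y′ = (j−2)·f·y·(4 − y)` on `I`. -/
theorem stmt14 (j : ℝ) (hj : 3 ≤ j) (I : Set ℝ) (hI : IsOpen I) (hI' : I.OrdConnected)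
    (h f h' f' : ℝ → ℝ)
    (hh : ∀ x ∈ I, HasDerivAt h (h' x) x)
    (hf : ∀ x ∈ I, HasDerivAt f (f' x) x)
    (hf0 : ∀ x ∈ I, f x ≠ 0)
    (D : ℝ → ℝ)
    (hD : ∀ x, D x = (j * x - (j - 2) * f x) ^ 2 - (j - 2) ^ 2 * f x * (h x) ^ 2)
    (hD0 : ∀ x ∈ I, D x ≠ 0)
    (heq1 : ∀ x ∈ I, D x * h' x = h x * (j * x + (j - 2) * f x))
    (heq2 : ∀ x ∈ I,
      D x * f' x = (j - 2) * f x * (h x) ^ 2 + 2 * f x * (j * x - (j - 2) * f x)) :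
    ∀ x ∈ I, DifferentiableAt ℝ (fun z => (h z) ^ 2 / f z) x ∧
      D x * deriv (fun z => (h z) ^ 2 / f z) x =
        (j - 2) * f x * ((h x) ^ 2 / f x) * (4 - (h x) ^ 2 / f x) := by
  intro x hx
  have hy := ((hh x hx).pow 2).div (hf x hx) (hf0 x hx)
  have hy2 : HasDerivAt (fun z => (h z) ^ 2 / f z)
      ((2 * h x * h' x * f x - (h x) ^ 2 * f' x) / (f x) ^ 2) x := by
    refine HasDerivAt.congr_deriv hy ?_
    simp
  refine ⟨hy2.differentiableAt, ?_⟩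
  rw [hy2.deriv]
  have h0 := hf0 x hx
  have e1 := heq1 x hx
  have e2 := heq2 x hx
  have key : D x * ((2 * h x * h' x * f x - (h x) ^ 2 * f' x) / (f x) ^ 2) =
      (2 * h x * f x * (D x * h' x) - (h x) ^ 2 * (D x * f' x)) / (f x) ^ 2 := by ring
  rw [key, e1, e2]
  field_simp
  ring
end

section
/- Fix an integer ν ≥ 1 and set F(y) = y·Q̂_ν(y)^{2ν−1} / ((2ν+1)²·B_ν(y)^{2ν+1}) and D̂(y) = ((2ν+1)·Q̂_ν(y) − (2ν−1)·B_ν(y))²/B_ν(y)² − (2ν−1)²·y. Then for every real y with y ≠ 0, y ≠ 4, B_ν(y) ≠ 0 and Q̂_ν(y) ≠ 0, the function F is differentiable at y and F′(y) = −(B_ν(y)/Q̂_ν(y))·F(y)·D̂(y)/(y·(y − 4)). -/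
/-- `B_ν(y) = Σ_{μ=0}^{ν} ((2ν)!/((2μ)!·((ν−μ)!)²))·y^μ` as a real function,
so that `B_ν(ζ²) = S_{2ν}(ζ)`. -/
noncomputable def Bfun (ν : ℕ) (y : ℝ) : ℝ :=
  ∑ μ ∈ Finset.range (ν + 1),
    (((2 * ν).factorial : ℝ) /
        ((Nat.factorial (2 * μ) * (Nat.factorial (ν - μ) * Nat.factorial (ν - μ)) : ℕ) : ℝ)) *
      y ^ μ

/-- `Q̂_ν(y) = Σ_{μ=0}^{ν} [(2ν)!/((2μ)!·((ν−μ)!)²) − (2ν)!/((2μ−1)!·(ν−μ)!·(ν−μ+1)!)]·y^μ`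
(the second term absent for `μ = 0`) as a real function, so that
`Q̂_ν(ζ²) = S_{2ν}(ζ) − ζ·R_{2ν}′(ζ)`. -/
noncomputable def Qfun (ν : ℕ) (y : ℝ) : ℝ :=
  ∑ μ ∈ Finset.range (ν + 1),
    ((((2 * ν).factorial : ℝ) /
        ((Nat.factorial (2 * μ) * (Nat.factorial (ν - μ) * Nat.factorial (ν - μ)) : ℕ) : ℝ)) -
      (if μ = 0 then 0 else
        ((2 * ν).factorial : ℝ) /
        ((Nat.factorial (2 * μ - 1) * (Nat.factorial (ν - μ) * Nat.factorial (ν - μ + 1)) : ℕ) : ℝ))) *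
      y ^ μ

noncomputable def bco (ν m : ℕ) : ℝ :=
  ((2 * ν).factorial : ℝ) /
        ((Nat.factorial (2 * m) * (Nat.factorial (ν - m) * Nat.factorial (ν - m)) : ℕ) : ℝ)

noncomputable def qco (ν μ : ℕ) : ℝ :=
  ((((2 * ν).factorial : ℝ) /
        ((Nat.factorial (2 * μ) * (Nat.factorial (ν - μ) * Nat.factorial (ν - μ)) : ℕ) : ℝ)) -
      (if μ = 0 then 0 else
        ((2 * ν).factorial : ℝ) /
        ((Nat.factorial (2 * μ - 1) * (Nat.factorial (ν - μ) * Nat.factorial (ν - μ + 1)) : ℕ) : ℝ)))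

lemma bco_rec (ν m : ℕ) (h : m < ν) :
    ((ν : ℝ) - m) ^ 2 * bco ν m = (2 * m + 2) * (2 * m + 1) * bco ν (m + 1) := by
  obtain ⟨k, rfl⟩ := Nat.exists_eq_add_of_lt h
  have e1 : m + k + 1 - m = k + 1 := by omega
  have e2 : m + k + 1 - (m + 1) = k := by omega
  have e3 : 2 * (m + 1) = 2 * m + 1 + 1 := by ring
  unfold bco
  rw [e1, e2, e3]
  generalize (2 * (m + k + 1)).factorial = A
  simp only [Nat.factorial_succ]
  have h1 : ((2 * m).factorial : ℝ) ≠ 0 := by positivity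
  have h2 : ((k).factorial : ℝ) ≠ 0 := by positivity
  have h3 : (k : ℝ) + 1 ≠ 0 := by positivity
  have h4 : 2 * (m : ℝ) + 1 ≠ 0 := by positivity
  have h5 : 2 * (m : ℝ) + 1 + 1 ≠ 0 := by positivity
  push_cast
  field_simp
  ring

lemma qco_eq (ν m : ℕ) (h : m ≤ ν) :
    qco ν m = ((ν : ℝ) + 1 - 3 * m) * (bco ν m / ((ν : ℝ) + 1 - m)) := by
  obtain ⟨k, rfl⟩ := Nat.exists_eq_add_of_le h
  have e1 : m + k - m = k := by omega
  have h3 : (k : ℝ) + 1 ≠ 0 := by positivity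
  have e4 : (((m + k : ℕ) : ℝ) + 1 - m) = k + 1 := by push_cast; ring
  have h2 : ((k).factorial : ℝ) ≠ 0 := by positivity
  unfold qco bco
  rw [e1, e4]
  generalize (2 * (m + k)).factorial = A
  rcases m with _ | m
  · simp
    field_simp
  · have e3 : 2 * (m + 1) = 2 * m + 1 + 1 := by ring
    rw [e3, if_neg (by omega), Nat.add_sub_cancel]
    simp only [Nat.factorial_succ]
    have h1 : ((2 * m).factorial : ℝ) ≠ 0 := by positivity
    have h4 : 2 * (m : ℝ) + 1 ≠ 0 := by positivity
    have h5 : 2 * (m : ℝ) + 1 + 1 ≠ 0 := by positivity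
    push_cast
    field_simp
    ring

noncomputable def gco (ν : ℕ) (y : ℝ) (m : ℕ) : ℝ :=
  -(2 * m * (2 * m - 1)) * (bco ν m / ((ν : ℝ) + 1 - m)) * y ^ m

lemma gco_zero (ν : ℕ) (y : ℝ) : gco ν y 0 = 0 := by simp [gco]

lemma gco_last (ν : ℕ) (y : ℝ) : gco ν y (ν + 1) = 0 := by simp [gco]

lemma gco_succ (ν : ℕ) (y : ℝ) (m : ℕ) (h : m ≤ ν) :
    gco ν y (m + 1) = -((ν : ℝ) - m) * bco ν m * y ^ (m + 1) := by
  rcases h.eq_or_lt with rfl | h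
  · simp [gco_last]
  · have hr := bco_rec ν m h
    have h0 : (ν : ℝ) - m ≠ 0 := by
      have : (m : ℝ) < ν := by exact_mod_cast h
      linarith
    have e : (ν : ℝ) + 1 - ((m + 1 : ℕ) : ℝ) = ν - m := by push_cast; ring
    unfold gco
    rw [e]
    have : bco ν m = (2 * m + 2) * (2 * m + 1) * bco ν (m + 1) / ((ν : ℝ) - m) ^ 2 := by
      field_simp
      linarith
    rw [this]
    push_cast
    field_simp
    ring

lemma gco_sum (ν : ℕ) (y : ℝ) :
    ∑ m ∈ Finset.range (ν + 1), (gco ν y (m + 1) - gco ν y m) = 0 := by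
  rw [Finset.sum_range_sub, gco_zero, gco_last, sub_zero]

noncomputable def dB (ν : ℕ) (y : ℝ) : ℝ :=
  ∑ m ∈ Finset.range (ν + 1), bco ν m * (m * y ^ (m - 1))

noncomputable def dQ (ν : ℕ) (y : ℝ) : ℝ :=
  ∑ m ∈ Finset.range (ν + 1), qco ν m * (m * y ^ (m - 1))

lemma hasDerivAt_B (ν : ℕ) (y : ℝ) : HasDerivAt (Bfun ν) (dB ν y) y :=
  HasDerivAt.fun_sum fun m _ => (hasDerivAt_pow m y).const_mul (bco ν m)

lemma hasDerivAt_Q (ν : ℕ) (y : ℝ) : HasDerivAt (Qfun ν) (dQ ν y) y :=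
  HasDerivAt.fun_sum fun m _ => (hasDerivAt_pow m y).const_mul (qco ν m)

lemma mul_pow_pred (m : ℕ) (y : ℝ) : y * (m * y ^ (m - 1)) = m * y ^ m := by
  rcases m with _ | m
  · simp
  · simp; ring

lemma B_eq (ν : ℕ) (y : ℝ) : Bfun ν y = ∑ m ∈ Finset.range (ν + 1), bco ν m * y ^ m := rfl

lemma Q_eq (ν : ℕ) (y : ℝ) : Qfun ν y = ∑ m ∈ Finset.range (ν + 1), qco ν m * y ^ m := rfl

lemma odeB (ν : ℕ) (y : ℝ) : y * (y - 4) * dB ν y =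
    (ν * y - (2 * ν + 1)) * Bfun ν y + (2 * ν + 1) * Qfun ν y := by
  rw [← sub_eq_zero, ← gco_sum ν y, B_eq, Q_eq, dB]
  simp only [Finset.mul_sum]
  rw [← Finset.sum_add_distrib, ← Finset.sum_sub_distrib]
  refine Finset.sum_congr rfl fun m hm => ?_
  have hm : m ≤ ν := by simpa [Nat.lt_succ_iff] using hm
  have hp := mul_pow_pred m y
  have h0 : (ν : ℝ) + 1 - m ≠ 0 := by
    have : (m : ℝ) ≤ ν := by exact_mod_cast hm
    linarith
  rw [gco_succ ν y m hm, qco_eq ν m hm, gco]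
  obtain ⟨c, hc⟩ : ∃ c, c = bco ν m / ((ν : ℝ) + 1 - m) := ⟨_, rfl⟩
  have hb : bco ν m = c * ((ν : ℝ) + 1 - m) := by rw [hc]; field_simp
  rw [← hc, hb]
  linear_combination (y - 4) * c * ((ν : ℝ) + 1 - m) * hp

lemma odeQ (ν : ℕ) (y : ℝ) : y * (y - 4) * dQ ν y =
    (2 * ν - 1) * (y - 1) * Bfun ν y + ((2 * ν - 1) + (ν + 1) * y) * Qfun ν y := by
  have hz : (0 : ℝ) = 3 * ∑ m ∈ Finset.range (ν + 1), (gco ν y (m + 1) - gco ν y m) := by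
    rw [gco_sum, mul_zero]
  rw [← sub_eq_zero]
  refine Eq.trans ?_ hz.symm
  rw [B_eq, Q_eq, dQ]
  simp only [Finset.mul_sum]
  rw [← Finset.sum_add_distrib, ← Finset.sum_sub_distrib]
  refine Finset.sum_congr rfl fun m hm => ?_
  have hm : m ≤ ν := by simpa [Nat.lt_succ_iff] using hm
  have hp := mul_pow_pred m y
  have h0 : (ν : ℝ) + 1 - m ≠ 0 := by
    have : (m : ℝ) ≤ ν := by exact_mod_cast hm
    linarith
  rw [gco_succ ν y m hm, qco_eq ν m hm, gco]
  obtain ⟨c, hc⟩ : ∃ c, c = bco ν m / ((ν : ℝ) + 1 - m) := ⟨_, rfl⟩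
  have hb : bco ν m = c * ((ν : ℝ) + 1 - m) := by rw [hc]; field_simp
  rw [← hc, hb]
  linear_combination (y - 4) * c * ((ν : ℝ) + 1 - 3 * m) * hp

/-- Fix `ν ≥ 1` and set `F(y) = y·Q̂_ν(y)^{2ν−1}/((2ν+1)²·B_ν(y)^{2ν+1})` and
`D̂(y) = ((2ν+1)·Q̂_ν(y) − (2ν−1)·B_ν(y))²/B_ν(y)² − (2ν−1)²·y`.  Then for every real `y`
with `y ≠ 0`, `y ≠ 4`, `B_ν(y) ≠ 0` and `Q̂_ν(y) ≠ 0`, `F` is differentiable at `y` and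
`F′(y) = −(B_ν(y)/Q̂_ν(y))·F(y)·D̂(y)/(y·(y − 4))`. -/
theorem stmt15 (ν : ℕ) (hν : 1 ≤ ν) (F Dhat : ℝ → ℝ)
    (hF : ∀ y : ℝ, F y =
      y * Qfun ν y ^ (2 * ν - 1) / ((2 * (ν : ℝ) + 1) ^ 2 * Bfun ν y ^ (2 * ν + 1)))
    (hDhat : ∀ y : ℝ, Dhat y =
      ((2 * (ν : ℝ) + 1) * Qfun ν y - (2 * (ν : ℝ) - 1) * Bfun ν y) ^ 2 / Bfun ν y ^ 2 -
        (2 * (ν : ℝ) - 1) ^ 2 * y)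
    (y : ℝ) (hy0 : y ≠ 0) (hy4 : y ≠ 4) (hB : Bfun ν y ≠ 0) (hQ : Qfun ν y ≠ 0) :
    DifferentiableAt ℝ F y ∧
      deriv F y = -(Bfun ν y / Qfun ν y) * F y * Dhat y / (y * (y - 4)) := by
  have h4 : y - 4 ≠ 0 := sub_ne_zero.mpr hy4
  have hC : (2 * (ν : ℝ) + 1) ≠ 0 := by positivity
  have hd := ((hasDerivAt_id' y).mul ((hasDerivAt_Q ν y).pow (2 * ν - 1))).div
    (((hasDerivAt_B ν y).pow (2 * ν + 1)).const_mul ((2 * (ν : ℝ) + 1) ^ 2))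
    (mul_ne_zero (pow_ne_zero 2 hC) (pow_ne_zero _ hB))
  have hd' := hd.congr_of_eventuallyEq (f₁ := F) (Filter.Eventually.of_forall fun x => hF x)
  refine ⟨hd'.differentiableAt, ?_⟩
  rw [hd'.deriv, hF, hDhat]
  have e1 : dB ν y = ((ν * y - (2 * ν + 1)) * Bfun ν y + (2 * ν + 1) * Qfun ν y) /
      (y * (y - 4)) := by
    rw [← odeB]; field_simp
  have e2 : dQ ν y = ((2 * ν - 1) * (y - 1) * Bfun ν y +
      ((2 * ν - 1) + (ν + 1) * y) * Qfun ν y) / (y * (y - 4)) := by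
    rw [← odeQ]; field_simp
  rw [e1, e2]
  simp only [Pi.pow_apply, Pi.mul_apply]
  generalize Bfun ν y = B at *
  generalize Qfun ν y = Q at *
  obtain ⟨n, rfl⟩ := Nat.exists_eq_add_of_le' hν
  have e5 : 2 * (n + 1) - 1 = 2 * n + 1 := by omega
  rw [e5]
  simp only [Nat.add_sub_cancel]
  push_cast at hC ⊢
  field_simp
  ring
end

section
/- (Edge Toda equations) Fix an integer j ≥ 1 and a real N > 0. Let a_n(t) and β_n(t) (n ∈ ℕ) be real quantities differentiable in t, with β₀ ≡ 0, and for each t let L be the linear operator on real sequences v : ℕ → ℝ given by (Lv)_n = v_{n+1} + a_n·v_n + β_n·v_{n−1} (the last term absent for n = 0); write L^r_{n,m} = (L^r δ_m)_n for the entries of its powers, where δ_m is the m-th standard basis sequence. Suppose that for all t: (i) the string equations hold, namely 0 = a_n + j·t·L^{j−1}_{n,n} for all n and n/N = β_n + j·t·L^{j−1}_{n,n−1} for all n ≥ 1; and (ii) the Toda equations hold, namely N⁻¹·∂_t a_n = L^j_{n,n−1} − L^j_{n+1,n} and N⁻¹·∂_t β_n = L^j_{n,n−2} − L^j_{n+1,n−1}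 + (a_{n−1} − a_n)·L^j_{n,n−1} for all n ≥ 2. Then for all n ≥ 2 the edge Toda equations hold: N⁻¹·(a_n + j·t·∂_t a_n) = a_{n+1}·β_{n+1} − a_n·β_n + a_n·β_{n+1} − a_{n−1}·β_n, and N⁻¹·(2·β_n + j·t·∂_t β_n) = β_n·(a_n² − a_{n−1}² + β_{n+1} − β_{n−1}). -/
/-- The tridiagonal recursion operator on real sequences:
`(Lv)_n = v_{n+1} + a_n·v_n + β_n·v_{n−1}` (the last term absent for `n = 0`). -/
noncomputable def Lop (a β : ℕ → ℝ) (v : ℕ → ℝ) : ℕ → ℝ :=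
  fun n => v (n + 1) + a n * v n + (if n = 0 then 0 else β n * v (n - 1))

/-- The `m`-th standard basis sequence. -/
noncomputable def stdBasis (m : ℕ) : ℕ → ℝ := fun k => if k = m then 1 else 0

/-- The entries of the powers of `L`: `L^r_{n,m} = (L^r δ_m)_n`. -/
noncomputable def Lent (a β : ℕ → ℝ) (r n m : ℕ) : ℝ :=
  ((Lop a β)^[r] (stdBasis m)) n

/-- Left multiplication: `L^{r+1} = L · L^r`. -/
lemma Lent_succ_left (a β : ℕ → ℝ) (r n m : ℕ) :
    Lent a β (r + 1) (n + 1) m =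
      Lent a β r (n + 2) m + a (n + 1) * Lent a β r (n + 1) m + β (n + 1) * Lent a β r n m := by
  unfold Lent
  rw [Function.iterate_succ_apply']
  simp [Lop]

/-- Linearity of the iterates of `L`. -/
lemma Lop_iterate_comb (a β : ℕ → ℝ) (r : ℕ) : ∀ (u v w : ℕ → ℝ) (x y : ℝ),
    (Lop a β)^[r] (fun k => u k + x * v k + y * w k) =
      fun k => ((Lop a β)^[r] u) k + x * ((Lop a β)^[r] v) k + y * ((Lop a β)^[r] w) k := by
  induction r with
  | zero => intros; rfl
  | succ r ih =>
    intro u v w x y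
    simp only [Function.iterate_succ_apply]
    rw [← ih]
    congr 1
    funext k
    unfold Lop
    split_ifs <;> ring

/-- Right multiplication: `L^{r+1} = L^r · L`. -/
lemma Lent_succ_right (a β : ℕ → ℝ) (r n m : ℕ) :
    Lent a β (r + 1) n (m + 1) =
      Lent a β r n m + a (m + 1) * Lent a β r n (m + 1) + β (m + 2) * Lent a β r n (m + 2) := by
  unfold Lent
  rw [Function.iterate_succ_apply]
  have h : Lop a β (stdBasis (m + 1)) =
      fun k => stdBasis m k + a (m + 1) * stdBasis (m + 1) k
        + β (m + 2) * stdBasis (m + 2) k := by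
    funext k
    unfold Lop stdBasis
    rcases k with _ | k
    · simp [eq_comm]
    · simp only [Nat.add_right_cancel_iff, Nat.add_sub_cancel, Nat.succ_ne_zero, if_false]
      congr 1
      · congr 1
        by_cases h : k = m
        · simp [h]
        · simp [h]
      · by_cases h : k = m + 1
        · simp [h]
        · simp [h]
  rw [h, Lop_iterate_comb]

/-- **Edge Toda equations.**  Fix an integer `j ≥ 1` and a real `N > 0`.  Let `a_n(t)` and
`β_n(t)` be real quantities differentiable in `t`, with `β₀ ≡ 0`.  Suppose the string
equations `0 = a_n + j·t·L^{j−1}_{n,n}` (for all `n`) and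
`n/N = β_n + j·t·L^{j−1}_{n,n−1}` (for all `n ≥ 1`) hold, together with the Toda equations
`N⁻¹·∂_t a_n = L^j_{n,n−1} − L^j_{n+1,n}` and
`N⁻¹·∂_t β_n = L^j_{n,n−2} − L^j_{n+1,n−1} + (a_{n−1} − a_n)·L^j_{n,n−1}` for all `n ≥ 2`.
Then for all `n ≥ 2` the edge Toda equations hold:
`N⁻¹·(a_n + j·t·∂_t a_n) = a_{n+1}·β_{n+1} − a_n·β_n + a_n·β_{n+1} − a_{n−1}·β_n` and
`N⁻¹·(2·β_n + j·t·∂_t β_n) = β_n·(a_n² − a_{n−1}² + β_{n+1} − β_{n−1})`. -/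
theorem stmt17 (j : ℕ) (hj : 1 ≤ j) (N : ℝ) (hN : 0 < N)
    (a β : ℝ → ℕ → ℝ)
    (hda : ∀ n : ℕ, Differentiable ℝ fun t => a t n)
    (hdβ : ∀ n : ℕ, Differentiable ℝ fun t => β t n)
    (hβ0 : ∀ t : ℝ, β t 0 = 0)
    (hstring1 : ∀ t : ℝ, ∀ n : ℕ,
      0 = a t n + (j : ℝ) * t * Lent (a t) (β t) (j - 1) n n)
    (hstring2 : ∀ t : ℝ, ∀ n : ℕ, 1 ≤ n →
      (n : ℝ) / N = β t n + (j : ℝ) * t * Lent (a t) (β t) (j - 1) n (n - 1))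
    (hTodaA : ∀ t : ℝ, ∀ n : ℕ, 2 ≤ n →
      N⁻¹ * deriv (fun s => a s n) t =
        Lent (a t) (β t) j n (n - 1) - Lent (a t) (β t) j (n + 1) n)
    (hTodaB : ∀ t : ℝ, ∀ n : ℕ, 2 ≤ n →
      N⁻¹ * deriv (fun s => β s n) t =
        Lent (a t) (β t) j n (n - 2) - Lent (a t) (β t) j (n + 1) (n - 1) +
          (a t (n - 1) - a t n) * Lent (a t) (β t) j n (n - 1)) :
    ∀ t : ℝ, ∀ n : ℕ, 2 ≤ n →
      (N⁻¹ * (a t n + (j : ℝ) * t * deriv (fun s => a s n) t) =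
        a t (n + 1) * β t (n + 1) - a t n * β t n +
          a t n * β t (n + 1) - a t (n - 1) * β t n) ∧
      (N⁻¹ * (2 * β t n + (j : ℝ) * t * deriv (fun s => β s n) t) =
        β t n * ((a t n) ^ 2 - (a t (n - 1)) ^ 2 + β t (n + 1) - β t (n - 1))) := by
  intro t n hn
  obtain ⟨i, rfl⟩ : ∃ i, j = i + 1 := ⟨j - 1, by omega⟩
  obtain ⟨k, rfl⟩ : ∃ k, n = k + 2 := ⟨n - 2, by omega⟩
  have hA := hTodaA t (k + 2) hn
  have hB := hTodaB t (k + 2) hn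
  have s1 := hstring1 t (k + 1)
  have s2 := hstring1 t (k + 2)
  have s3 := hstring1 t (k + 3)
  have q1 := hstring2 t (k + 1) (by omega)
  have q2 := hstring2 t (k + 2) (by omega)
  have q3 := hstring2 t (k + 3) (by omega)
  simp only [show k + 2 - 1 = k + 1 from rfl, show k + 2 - 2 = k from rfl,
    show k + 3 - 1 = k + 2 from rfl, show k + 1 - 1 = k from rfl,
    show i + 1 - 1 = i from rfl, show k + 2 + 1 = k + 3 from rfl] at *
  have l1 := Lent_succ_left (a t) (β t) i (k + 1) (k + 1)
  have r1 := Lent_succ_right (a t) (β t) i (k + 2) k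
  have r2 := Lent_succ_right (a t) (β t) i (k + 3) (k + 1)
  have l3 := Lent_succ_left (a t) (β t) i (k + 1) k
  have r3 := Lent_succ_right (a t) (β t) i (k + 3) k
  simp only [show k + 1 + 1 = k + 2 from rfl, show k + 1 + 2 = k + 3 from rfl] at l1 r1 r2 l3 r3
  simp only [div_eq_mul_inv] at q1 q2 q3
  push_cast at *
  generalize deriv (fun s => a s (k + 2)) t = da at *
  generalize deriv (fun s => β s (k + 2)) t = db at *
  constructor
  · linear_combination ((i : ℝ) + 1) * t * (hA + l1 - r2) + a t (k + 2) * (q3 - q2)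
      - β t (k + 2) * s1 + β t (k + 3) * s3
  · linear_combination ((i : ℝ) + 1) * t * (hB + l3 - r3 + a t (k + 1) * l1 - a t (k + 2) * r1)
      + β t (k + 2) * (q3 - q1 - a t (k + 1) * s1 + a t (k + 2) * s2)
end

section
/- Let C₁ < 0, C₂ > 0, and z > 0 be real numbers, and let ζ : {1, 2, 3, …} → ℝ be a sequence with ζ₁ > 0 satisfying, for every g ≥ 1, the recurrence 0 = ζ_{g+1} + C₁·C₂·z^{2g−1}·(25g² − 1)·ζ_g + 6·C₁·Σ_{m=1}^{g} ζ_m·ζ_{g+1−m}. Then ζ_g > 0 for all g ≥ 1. -/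
/-- Let `C₁ < 0`, `C₂ > 0`, `z > 0`, and let `ζ : ℕ → ℝ` (indexed from `1`) satisfy
`ζ₁ > 0` and, for every `g ≥ 1`, the recurrence
`0 = ζ_{g+1} + C₁·C₂·z^{2g−1}·(25g² − 1)·ζ_g + 6·C₁·Σ_{m=1}^{g} ζ_m·ζ_{g+1−m}`.
Then `ζ_g > 0` for all `g ≥ 1`. -/
theorem stmt18 (C₁ C₂ z : ℝ) (hC₁ : C₁ < 0) (hC₂ : 0 < C₂) (hz : 0 < z)
    (ζ : ℕ → ℝ) (hζ1 : 0 < ζ 1)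
    (hrec : ∀ g : ℕ, 1 ≤ g →
      0 = ζ (g + 1) + C₁ * C₂ * z ^ (2 * g - 1) * (25 * (g : ℝ) ^ 2 - 1) * ζ g +
        6 * C₁ * ∑ m ∈ Finset.Icc 1 g, ζ m * ζ (g + 1 - m)) :
    ∀ g : ℕ, 1 ≤ g → 0 < ζ g := by
  intro g
  induction g using Nat.strong_induction_on with
  | _ n ih =>
    intro hn
    rcases Nat.eq_or_lt_of_le hn with h1 | h1
    · rw [← h1]; exact hζ1
    · obtain ⟨g, rfl⟩ : ∃ g, n = g + 1 := ⟨n - 1, by omega⟩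
      have hg : 1 ≤ g := by omega
      have h := hrec g hg
      have hζg : 0 < ζ g := ih g (by omega) hg
      have hS : 0 ≤ ∑ m ∈ Finset.Icc 1 g, ζ m * ζ (g + 1 - m) := by
        apply Finset.sum_nonneg
        intro m hm
        rw [Finset.mem_Icc] at hm
        exact (mul_pos (ih m (by omega) hm.1) (ih (g + 1 - m) (by omega) (by omega))).le
      have hgR : (1 : ℝ) ≤ (g : ℝ) := by exact_mod_cast hg
      have hq : 0 < 25 * (g : ℝ) ^ 2 - 1 := by nlinarith
      have hD : 0 < -C₁ := by linarith
      have hA : 0 < (-C₁) * C₂ * z ^ (2 * g - 1) * (25 * (g : ℝ) ^ 2 - 1) * ζ g :=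
        mul_pos (mul_pos (mul_pos (mul_pos hD hC₂) (pow_pos hz _)) hq) hζg
      have hB : 0 ≤ (-C₁) * ∑ m ∈ Finset.Icc 1 g, ζ m * ζ (g + 1 - m) :=
        mul_nonneg hD.le hS
      linarith
end

section
/- Let j ≥ 3 be a real number, W > 0, and let h, f : (0, W) → ℝ be twice differentiable functions with f > 0 everywhere, satisfying the ODE system −h(w) + j·w·h′(w) = (j−2)·(h(w)·f′(w) + h′(w)·f(w)) and −2·f(w) + j·w·f′(w) = (j−2)·f(w)·(h(w)·h′(w) + f′(w)) for all w ∈ (0, W). Define E₀(w) = (1/2)·w²·log(f(w)/w) + 3(j−2)·w²/(4j) − ((j−2)(j+1)·w/(j(j+2)))·(f(w) + (1/2)·h(w)²) + ((j−2)²/(2j(j+2)))·((1/2)·f(w)² + h(w)²·f(w)). Then E₀″(w) = log(f(w)/w) for all w ∈ (0, W). -/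
/-- Let `j ≥ 3`, `W > 0`, and let `h, f : (0,W) → ℝ` be twice differentiable with `f > 0`,
satisfying the ODE system
`−h + j·w·h′ = (j−2)·(h·f′ + h′·f)` and `−2·f + j·w·f′ = (j−2)·f·(h·h′ + f′)`.
With
`E₀(w) = (1/2)·w²·log(f/w) + 3(j−2)·w²/(4j) − ((j−2)(j+1)·w/(j(j+2)))·(f + (1/2)·h²)
 + ((j−2)²/(2j(j+2)))·((1/2)·f² + h²·f)`,
one has `E₀″(w) = log(f(w)/w)` for all `w ∈ (0, W)`. -/
theorem stmt19 (j : ℝ) (hj : 3 ≤ j) (W : ℝ) (hW : 0 < W)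
    (h f h' f' h'' f'' : ℝ → ℝ)
    (hh : ∀ w ∈ Set.Ioo (0 : ℝ) W, HasDerivAt h (h' w) w)
    (hh' : ∀ w ∈ Set.Ioo (0 : ℝ) W, HasDerivAt h' (h'' w) w)
    (hf : ∀ w ∈ Set.Ioo (0 : ℝ) W, HasDerivAt f (f' w) w)
    (hf' : ∀ w ∈ Set.Ioo (0 : ℝ) W, HasDerivAt f' (f'' w) w)
    (hfpos : ∀ w ∈ Set.Ioo (0 : ℝ) W, 0 < f w)
    (hode1 : ∀ w ∈ Set.Ioo (0 : ℝ) W,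
      -h w + j * w * h' w = (j - 2) * (h w * f' w + h' w * f w))
    (hode2 : ∀ w ∈ Set.Ioo (0 : ℝ) W,
      -2 * f w + j * w * f' w = (j - 2) * f w * (h w * h' w + f' w))
    (E₀ : ℝ → ℝ)
    (hE₀ : ∀ w : ℝ, E₀ w =
      (1 / 2) * w ^ 2 * Real.log (f w / w) + 3 * (j - 2) * w ^ 2 / (4 * j) -
        ((j - 2) * (j + 1) * w / (j * (j + 2))) * (f w + (1 / 2) * (h w) ^ 2) +
        ((j - 2) ^ 2 / (2 * j * (j + 2))) * ((1 / 2) * (f w) ^ 2 + (h w) ^ 2 * f w)) :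
    ∀ w ∈ Set.Ioo (0 : ℝ) W, deriv (deriv E₀) w = Real.log (f w / w) := by
  have hj0 : j ≠ 0 := by linarith
  have hj2 : j + 2 ≠ 0 := by linarith
  have ha : j - 2 ≠ 0 := by intro hc; linarith
  have hlog : ∀ w ∈ Set.Ioo (0 : ℝ) W,
      HasDerivAt (fun w => Real.log (f w / w)) (f' w / f w - 1 / w) w := by
    intro w hw
    have hw0 : w ≠ 0 := hw.1.ne'
    have hf0 : f w ≠ 0 := (hfpos w hw).ne'
    have := ((hf w hw).div (hasDerivAt_id w) hw0).log (div_ne_zero hf0 hw0)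
    refine this.congr_deriv ?_
    simp only [id, Pi.div_apply]
    field_simp
  have hfun : E₀ = fun w => (1 / 2) * w ^ 2 * Real.log (f w / w) + 3 * (j - 2) * w ^ 2 / (4 * j) -
        ((j - 2) * (j + 1) * w / (j * (j + 2))) * (f w + (1 / 2) * (h w) ^ 2) +
        ((j - 2) ^ 2 / (2 * j * (j + 2))) * ((1 / 2) * (f w) ^ 2 + (h w) ^ 2 * f w) :=
    funext hE₀
  have hD1 : ∀ w ∈ Set.Ioo (0 : ℝ) W, HasDerivAt E₀
      (w * Real.log (f w / w) + (j - 2) / j * (w - f w - (1 / 2) * (h w) ^ 2)) w := by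
    intro w hw
    have hw0 : w ≠ 0 := hw.1.ne'
    have hf0 : f w ≠ 0 := (hfpos w hw).ne'
    rw [hfun]
    have hid := hasDerivAt_id' w
    have d1 := ((hid.pow 2).const_mul (1 / 2 : ℝ)).mul (hlog w hw)
    have d2 := ((hid.pow 2).const_mul (3 * (j - 2))).div_const (4 * j)
    have d3 := ((hid.const_mul ((j - 2) * (j + 1))).div_const (j * (j + 2))).mul
      ((hf w hw).add (((hh w hw).pow 2).const_mul (1 / 2 : ℝ)))
    have d4 := ((((hf w hw).pow 2).const_mul (1 / 2 : ℝ)).add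
      (((hh w hw).pow 2).mul (hf w hw))).const_mul ((j - 2) ^ 2 / (2 * j * (j + 2)))
    refine (((d1.add d2).sub d3).add d4).congr_deriv ?_
    have h1 := hode1 w hw
    have h2 := hode2 w hw
    simp only [Pi.add_apply, Pi.mul_apply, Pi.pow_apply]
    generalize Real.log (f w / w) = L
    generalize h w = H at *
    generalize f w = F at *
    generalize h' w = H' at *
    generalize f' w = F' at *
    have e1 : F' / F = ((j - 2) * (H * H' + F') + 2) / (j * w) := by
      field_simp
      linear_combination h2
    rw [e1]
    field_simp
    push_cast
    ring_nf
    linear_combination (-8 * (j - 2)) * (H * h1 + h2)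
  intro w hw
  have hw0 : w ≠ 0 := hw.1.ne'
  have hf0 : f w ≠ 0 := (hfpos w hw).ne'
  have hev : deriv E₀ =ᶠ[nhds w] fun w =>
      w * Real.log (f w / w) + (j - 2) / j * (w - f w - (1 / 2) * (h w) ^ 2) := by
    filter_upwards [isOpen_Ioo.mem_nhds hw] with x hx using (hD1 x hx).deriv
  rw [hev.deriv_eq]
  have hid := hasDerivAt_id' w
  have d := (hid.mul (hlog w hw)).add
    (((hid.sub (hf w hw)).sub (((hh w hw).pow 2).const_mul (1 / 2 : ℝ))).const_mul ((j - 2) / j))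
  refine (d.congr_deriv ?_).deriv
  have h2 := hode2 w hw
  generalize Real.log (f w / w) = L
  generalize h w = H at *
  generalize f w = F at *
  generalize h' w = H' at *
  generalize f' w = F' at *
  have e1 : F' / F = ((j - 2) * (H * H' + F') + 2) / (j * w) := by
    field_simp
    linear_combination h2
  rw [e1]
  field_simp
  push_cast
  ring
end
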